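/- arXiv:1109.4914 — 2 statements merged into one kernel-verified Lean document; each statement's English description precedes it below -/
import Mathlib

section
/- Let ℍ be a finite quotient of the Kagome lattice tiled by k = v(ℍ)/36 large hexagonal tiles. Each large hexagonal tile admits two configurations A and B, each consisting of an induced matching of 8 edges inside the tile together with a transversal of it. For every sequence s ∈ {A,B}^k of choices of configurations, one for each tile, the union M(s) of the chosen matchings is an induced matching of size 8k in ℍ, and the union σ(s) of the chosen transversals is a dominating transversal of M(s) in ℍ. Moreover, for any two sequences s, t ∈ {A,B}^k, the pairing ⟨σ(t)^∨, α_{M(s)}⟩ equals 0 whenever there is an index i with t_i = B and s_i = A, and equals ±1 otherwise; consequently the matrix of pairings (indexed lexicographically) is triangular with ±1 diagonal and the 2^k classes α_{M(s)} ∈ H̃_{8k-1}(I(ℍ); ℚ) are linearly independent. -/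
attribute [local instance] Classical.propDecidable

noncomputable section

open Finset Module
open scoped DirectSum

universe u

/-- An abstract simplicial complex on vertex type `V`, encoded by its set of faces
(finite subsets of `V`), required to be downward closed and to contain the empty face.
(The complex with only the empty face is the "empty complex", i.e. `S^{-1}`.) -/
structure SComplex (V : Type u) where
  faces : Set (Finset V)
  empty_mem : ∅ ∈ faces
  down_closed : ∀ {s t : Finset V}, s ∈ faces → t ⊆ s → t ∈ faces

namespace SComplex

variable {V : Type u}

/-- Ordered `j`-simplices of `K`: tuples of `j` vertices (repetitions allowed) spanning a
face of `K`.  Chains on these compute the reduced homology of `K` (this is the augmented,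
unnormalized chain complex of the simplicial set associated to `K`); the level `j`
corresponds to reduced degree `j - 1`. -/
def OSimplex (K : SComplex V) (j : ℕ) : Type u :=
  {t : Fin j → V // Finset.univ.image t ∈ K.faces}

/-- The `ℚ`-vector space of (level `j`, i.e. reduced degree `j-1`) simplicial chains. -/
abbrev Chain (K : SComplex V) (j : ℕ) : Type u := OSimplex K j →₀ ℚ

/-- The basis chain corresponding to a single ordered simplex. -/
def ofSimplex (K : SComplex V) (j : ℕ) (s : OSimplex K j) : Chain K j :=
  Finsupp.single s 1

/-- Boundary of a single ordered simplex: the alternating sum of its facets. -/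
def bdryO (K : SComplex V) (j : ℕ) (s : OSimplex K (j + 1)) : Chain K j :=
  ∑ i : Fin (j + 1), Finsupp.single
    ⟨s.1 ∘ i.succAbove, K.down_closed s.2 (by
      intro v hv
      simp only [Finset.mem_image] at hv ⊢
      obtain ⟨w, -, rfl⟩ := hv
      exact ⟨i.succAbove w, Finset.mem_univ _, rfl⟩)⟩
    ((-1 : ℚ) ^ (i : ℕ))

/-- The simplicial boundary map (from level `j+1` to level `j`). -/
def bdry (K : SComplex V) (j : ℕ) : Chain K (j + 1) →ₗ[ℚ] Chain K j :=
  Finsupp.lsum ℚ fun s => LinearMap.toSpanSingleton ℚ (Chain K j) (bdryO K j s)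

/-- Cycles at level `j` (reduced degree `j - 1`).  At level `0` (spanned by the empty
simplex) every chain is a cycle: this is the augmented complex. -/
def cyclesAt (K : SComplex V) : (j : ℕ) → Submodule ℚ (Chain K j)
  | 0 => ⊤
  | j + 1 => LinearMap.ker (bdry K j)

/-- Boundaries at level `j`. -/
def boundariesAt (K : SComplex V) (j : ℕ) : Submodule ℚ (Chain K j) :=
  LinearMap.range (bdry K j)

/-- Reduced simplicial homology with rational coefficients:
`homologyAt K j` is the reduced homology group `H̃_{j-1}(K; ℚ)`
(so `homologyAt K 0 = H̃_{-1}`, `homologyAt K (i+1) = H̃_i`). -/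
abbrev homologyAt (K : SComplex V) (j : ℕ) : Type u :=
  cyclesAt K j ⧸ ((boundariesAt K j).comap (cyclesAt K j).subtype)

/-- The homology class of a cycle. -/
def hClass (K : SComplex V) (j : ℕ) (z : Chain K j) (hz : z ∈ cyclesAt K j) :
    homologyAt K j :=
  Submodule.Quotient.mk ⟨z, hz⟩

/-- The reduced Betti number `β̃_{j-1}(K) = dim_ℚ H̃_{j-1}(K; ℚ)`. -/
def bettiAt (K : SComplex V) (j : ℕ) : ℕ := finrank ℚ (homologyAt K j)

/-- The total reduced Betti number `β̃(K) = ∑_i β̃_i(K)` (including degree `-1`). -/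
def totalBetti (K : SComplex V) : ℕ := finrank ℚ (⨁ j : ℕ, homologyAt K j)

/-- Simplicial cochains with rational coefficients. -/
abbrev Cochain (K : SComplex V) (j : ℕ) : Type u := Chain K j →ₗ[ℚ] ℚ

/-- The simplicial coboundary map, the transpose of the boundary. -/
def cobdry (K : SComplex V) (j : ℕ) : Cochain K j →ₗ[ℚ] Cochain K (j + 1) :=
  (bdry K j).dualMap

/-- Cocycles at level `j` (reduced degree `j-1`). -/
def cocyclesAt (K : SComplex V) (j : ℕ) : Submodule ℚ (Cochain K j) :=
  LinearMap.ker (cobdry K j)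

/-- Coboundaries at level `j`. -/
def cobordsAt (K : SComplex V) : (j : ℕ) → Submodule ℚ (Cochain K j)
  | 0 => ⊥
  | j + 1 => LinearMap.range (cobdry K j)

/-- Reduced simplicial cohomology with rational coefficients:
`cohomologyAt K j` is `H̃^{j-1}(K; ℚ)`. -/
abbrev cohomologyAt (K : SComplex V) (j : ℕ) : Type u :=
  cocyclesAt K j ⧸ ((cobordsAt K j).comap (cocyclesAt K j).subtype)

/-- The cohomology class of a cocycle. -/
def hcClass (K : SComplex V) (j : ℕ) (γ : Cochain K j) (hγ : γ ∈ cocyclesAt K j) :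
    cohomologyAt K j :=
  Submodule.Quotient.mk ⟨γ, hγ⟩

/-- Evaluation of a cocycle on homology classes. -/
def pairingAux (K : SComplex V) (j : ℕ) (γ : cocyclesAt K j) :
    homologyAt K j →ₗ[ℚ] ℚ :=
  Submodule.liftQ _ ((γ : Cochain K j).comp (cyclesAt K j).subtype) (by
    rintro ⟨z, hz⟩ hmem
    simp only [Submodule.mem_comap, Submodule.subtype_apply] at hmem
    obtain ⟨x, hx⟩ := hmem
    simp only [LinearMap.mem_ker, LinearMap.comp_apply, Submodule.subtype_apply]
    have hker : cobdry K j (γ : Cochain K j) = 0 := γ.2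
    have h2 : (cobdry K j (γ : Cochain K j)) x = 0 := by rw [hker]; rfl
    calc (γ : Cochain K j) z = (γ : Cochain K j) (bdry K j x) := by rw [hx]
      _ = (cobdry K j (γ : Cochain K j)) x := rfl
      _ = 0 := h2)

/-- The evaluation pairing `⟨·,·⟩ : H̃^{j-1}(K;ℚ) ⊗ H̃_{j-1}(K;ℚ) → ℚ`
given by evaluating cochains on chains. -/
def pairing (K : SComplex V) (j : ℕ) :
    cohomologyAt K j →ₗ[ℚ] homologyAt K j →ₗ[ℚ] ℚ :=
  Submodule.liftQ _
    { toFun := fun γ => pairingAux K j γ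
      map_add' := by
        intro γ δ
        apply LinearMap.ext
        intro x
        obtain ⟨⟨z, hz⟩, rfl⟩ := Submodule.Quotient.mk_surjective _ x
        simp [pairingAux, Submodule.liftQ_apply]
      map_smul' := by
        intro c γ
        apply LinearMap.ext
        intro x
        obtain ⟨⟨z, hz⟩, rfl⟩ := Submodule.Quotient.mk_surjective _ x
        simp [pairingAux, Submodule.liftQ_apply] }
    (by
      rintro ⟨γ, hγ⟩ hmem
      simp only [Submodule.mem_comap, Submodule.subtype_apply] at hmem
      simp only [LinearMap.mem_ker]
      apply LinearMap.ext
      intro x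
      obtain ⟨⟨z, hz⟩, rfl⟩ := Submodule.Quotient.mk_surjective _ x
      simp only [LinearMap.coe_mk, AddHom.coe_mk, LinearMap.zero_apply]
      cases j with
      | zero =>
          have : γ = 0 := by simpa [cobordsAt] using hmem
          simp [pairingAux, Submodule.liftQ_apply, this]
      | succ j =>
          obtain ⟨η, hη⟩ := hmem
          have hz0 : bdry K j z = 0 := hz
          simp only [pairingAux, Submodule.liftQ_apply]
          calc γ.comp (cyclesAt K (j+1)).subtype ⟨z, hz⟩ = γ z := rfl
            _ = (cobdry K j η) z := by rw [hη]
            _ = η (bdry K j z) := rfl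
            _ = 0 := by rw [hz0]; exact map_zero η)

end SComplex
section Graphs

open SComplex

variable {V : Type u}

/-- The independence complex `I(G)` of a graph `G`: faces are the independent sets. -/
def indepComplex (G : SimpleGraph V) : SComplex V where
  faces := {s : Finset V | ∀ v ∈ s, ∀ w ∈ s, ¬ G.Adj v w}
  empty_mem := by simp
  down_closed := by
    intro s t hs hts v hv w hw
    exact hs v (hts hv) w (hts hw)

/-- `s` is an independent set of the graph `G`. -/
def IsIndepSet (G : SimpleGraph V) (s : Finset V) : Prop :=
  ∀ v ∈ s, ∀ w ∈ s, ¬ G.Adj v w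

/-- `σ` is a dominating set of `G`: every vertex is in the closed neighbourhood `N[σ]`. -/
def IsDominating (G : SimpleGraph V) (σ : Finset V) : Prop :=
  ∀ v : V, ∃ w ∈ σ, w = v ∨ G.Adj w v

/-- The closed neighbourhood `N[σ]` of a finite set of vertices. -/
def closedNbhd (G : SimpleGraph V) (σ : Finset V) : Set V :=
  {v | ∃ w ∈ σ, w = v ∨ G.Adj w v}

/-- An induced matching of size `k` in `G`: `k` edges `(fst i, snd i)` such that
any two vertices belonging to distinct edges are distinct and non-adjacent. -/
structure InducedMatching (G : SimpleGraph V) (k : ℕ) where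
  fst : Fin k → V
  snd : Fin k → V
  adj : ∀ i, G.Adj (fst i) (snd i)
  disjoint : ∀ i j, i ≠ j → fst i ≠ fst j ∧ fst i ≠ snd j ∧ snd i ≠ fst j ∧ snd i ≠ snd j
  induced : ∀ i j, i ≠ j → ¬ G.Adj (fst i) (fst j) ∧ ¬ G.Adj (fst i) (snd j) ∧
    ¬ G.Adj (snd i) (fst j) ∧ ¬ G.Adj (snd i) (snd j)

namespace InducedMatching

variable {G : SimpleGraph V} {k : ℕ}

/-- The set of vertices covered by the matching. -/
def vertexFinset (M : InducedMatching G k) : Finset V :=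
  Finset.univ.image M.fst ∪ Finset.univ.image M.snd

/-- A transversal of a matching: a set of vertices of the matching containing exactly one
vertex from each edge. -/
def IsTransversal (M : InducedMatching G k) (σ : Finset V) : Prop :=
  σ ⊆ M.vertexFinset ∧
    ∀ i, (M.fst i ∈ σ ∧ M.snd i ∉ σ) ∨ (M.snd i ∈ σ ∧ M.fst i ∉ σ)

/-- The chain `([v_1] - [w_1]) ∧ ⋯ ∧ ([v_k] - [w_k])` representing the image `α_M` of the
fundamental class of the sphere `I(M) = S^{k-1}` in `I(G)`. -/
def matchingChain (M : InducedMatching G k) : Chain (indepComplex G) k :=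
  ∑ c : Fin k → Bool,
    ((-1 : ℚ) ^ (Finset.univ.filter (fun i => c i = true)).card) •
      Finsupp.single
        ⟨fun i => if c i then M.snd i else M.fst i, by
          intro v hv w hw
          simp only [Finset.mem_image, Finset.mem_univ, true_and] at hv hw
          obtain ⟨i, rfl⟩ := hv
          obtain ⟨j, rfl⟩ := hw
          by_cases hij : i = j
          · subst hij
            by_cases h : c i <;> simp [h, SimpleGraph.irrefl]
          · obtain ⟨h1, h2, h3, h4⟩ := M.induced i j hij
            by_cases hi : c i <;> by_cases hj : c j <;> simp [hi, hj, h1, h2, h3, h4]⟩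
        1

end InducedMatching

namespace SComplex

/-- The coefficient of the cochain `σ^∨` on an ordered simplex: `±1` (the sign of the
corresponding permutation) on the orderings of `σ` and `0` on all other simplices. -/
def dualCoeff (K : SComplex V) (k : ℕ) (σ : Finset V) (s : OSimplex K k) : ℚ :=
  if h : Function.Injective s.1 ∧ Finset.univ.image s.1 = σ then
    have hcard : Fintype.card {x // x ∈ σ} = k := by
      rw [Fintype.card_coe, ← h.2, Finset.card_image_of_injective _ h.1]
      simp
    ((Equiv.Perm.sign
      ((Equiv.ofBijective
          (fun i : Fin k => (⟨s.1 i, by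
            rw [← h.2]; exact Finset.mem_image_of_mem _ (Finset.mem_univ i)⟩ : {x // x ∈ σ}))
          (by
            rw [Fintype.bijective_iff_injective_and_card]
            exact ⟨fun a b hab => h.1 (congrArg Subtype.val hab), by simp [hcard]⟩)).trans
        (Fintype.equivFinOfCardEq hcard)) : ℤ) : ℚ)
  else 0

/-- The cochain `σ^∨` associated to an independent set `σ` of cardinality `k`: it assigns
`±1` to the two orientations of `σ` and `0` to all other simplices.  When `σ` is a maximal
independent set this cochain is a cocycle. -/
def dualCochain (K : SComplex V) (k : ℕ) (σ : Finset V) : Cochain K k :=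
  Finsupp.linearCombination ℚ (dualCoeff K k σ)

end SComplex

end Graphs
section Kagome

/-- `i'` is the cyclic successor of `i` in `Fin N`. -/
def finSucc {N : ℕ} (i i' : Fin N) : Prop := (i' : ℕ) = ((i : ℕ) + 1) % N

/-- Generating relation for the Kagome (hexagonal dimer) lattice with periodic boundary
conditions: cells are indexed by `Fin n × Fin q` (a cell is a `(2,0) × (0,2√3)` box) and
each cell contains six vertices, labelled by `Fin 6`:
`0 = (2i, 2j√3)`, `1 = (2i+1, 2j√3)` (a full horizontal row),
`2 = (2i+1/2, 2j√3+√3/2)` (a sparse row),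
`3 = (2i, 2j√3+√3)`, `4 = (2i+1, 2j√3+√3)` (the next full row),
`5 = (2i+3/2, 2j√3+3√3/2)` (the next sparse row).
The edges are the horizontal edges of the full rows together with the corner-sharing
up/down triangles through the sparse vertices `2` and `5`. -/
def kagomeRel (n q : ℕ) :
    (Fin n × Fin q) × Fin 6 → (Fin n × Fin q) × Fin 6 → Prop :=
  fun x y =>
    (x.2 = 0 ∧ y.2 = 1 ∧ y.1 = x.1) ∨
    (x.2 = 1 ∧ y.2 = 0 ∧ finSucc x.1.1 y.1.1 ∧ y.1.2 = x.1.2) ∨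
    (x.2 = 3 ∧ y.2 = 4 ∧ y.1 = x.1) ∨
    (x.2 = 4 ∧ y.2 = 3 ∧ finSucc x.1.1 y.1.1 ∧ y.1.2 = x.1.2) ∨
    (x.2 = 2 ∧ (y.2 = 0 ∨ y.2 = 1 ∨ y.2 = 3 ∨ y.2 = 4) ∧ y.1 = x.1) ∨
    (x.2 = 5 ∧ ((y.2 = 4 ∧ y.1 = x.1) ∨
      (y.2 = 3 ∧ finSucc x.1.1 y.1.1 ∧ y.1.2 = x.1.2) ∨
      (y.2 = 1 ∧ y.1.1 = x.1.1 ∧ finSucc x.1.2 y.1.2) ∨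
      (y.2 = 0 ∧ finSucc x.1.1 y.1.1 ∧ finSucc x.1.2 y.1.2)))

/-- The Kagome lattice with `n × q` cells of six vertices (periodic boundary
conditions). -/
def kagomeAux (n q : ℕ) : SimpleGraph ((Fin n × Fin q) × Fin 6) :=
  SimpleGraph.fromRel (kagomeRel n q)

/-- The quotient `ℍ_{n,m}` of the Kagome (hexagonal dimer) lattice by the translation
group generated by `n·(2,0)` and `m·(0,√3)`; it has `3·n·m` vertices.  (One box of the
`kagomeAux` model has height `2√3`, hence accounts for two `(0,√3)`-translations.) -/
def kagomeGraph (n m : ℕ) : SimpleGraph ((Fin n × Fin (m / 2)) × Fin 6) :=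
  kagomeAux n (m / 2)

end Kagome
section Hom
open SComplex

variable {V : Type u}

def faceS {K : SComplex V} {j : ℕ} (s : OSimplex K (j + 1)) (i : Fin (j + 1)) : OSimplex K j :=
  ⟨s.1 ∘ i.succAbove, K.down_closed s.2 (by
      intro v hv
      simp only [Finset.mem_image] at hv ⊢
      obtain ⟨w, -, rfl⟩ := hv
      exact ⟨i.succAbove w, Finset.mem_univ _, rfl⟩)⟩

theorem bdry_single (K : SComplex V) (j : ℕ) (s : OSimplex K (j + 1)) :
    bdry K j (Finsupp.single s 1) = ∑ i : Fin (j + 1),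
      (Finsupp.single (faceS s i) ((-1 : ℚ) ^ (i : ℕ)) : Chain K j) := by
  have : bdry K j (Finsupp.single s 1) = bdryO K j s := by
    unfold bdry
    rw [Finsupp.lsum_single, LinearMap.toSpanSingleton_apply, one_smul]
  rw [this]
  rfl

theorem dual_single (K : SComplex V) (k : ℕ) (σ : Finset V) (s : OSimplex K k) (a : ℚ) :
    dualCochain K k σ (Finsupp.single s a) = a * dualCoeff K k σ s := by
  unfold dualCochain
  rw [Finsupp.linearCombination_single, smul_eq_mul]

def selS {G : SimpleGraph V} {k : ℕ} (M : InducedMatching G k) (c : Fin k → Bool) :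
    OSimplex (indepComplex G) k :=
  ⟨fun i => if c i then M.snd i else M.fst i, by
          intro v hv w hw
          simp only [Finset.mem_image, Finset.mem_univ, true_and] at hv hw
          obtain ⟨i, rfl⟩ := hv
          obtain ⟨j, rfl⟩ := hw
          by_cases hij : i = j
          · subst hij
            by_cases h : c i <;> simp [h, SimpleGraph.irrefl]
          · obtain ⟨h1, h2, h3, h4⟩ := M.induced i j hij
            by_cases hi : c i <;> by_cases hj : c j <;> simp [hi, hj, h1, h2, h3, h4]⟩

theorem matchingChain_eq {G : SimpleGraph V} {k : ℕ} (M : InducedMatching G k) :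
    M.matchingChain = ∑ c : Fin k → Bool,
    ((-1 : ℚ) ^ (Finset.univ.filter (fun i => c i = true)).card) •
      (Finsupp.single (selS M c) 1 : Chain (indepComplex G) k) := rfl

theorem sign_prod {k : ℕ} (c : Fin k → Bool) :
    (-1 : ℚ) ^ (Finset.univ.filter (fun j => c j = true)).card
      = ∏ j, (if c j = true then (-1 : ℚ) else 1) := by
  rw [Finset.prod_ite]
  simp

theorem matchingChain_cycle {G : SimpleGraph V} {k : ℕ} (M : InducedMatching G k) :
    M.matchingChain ∈ cyclesAt (indepComplex G) k := by
  cases k with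
  | zero => exact Submodule.mem_top
  | succ k =>
    show bdry (indepComplex G) k M.matchingChain = 0
    rw [matchingChain_eq, map_sum]
    simp only [map_smul, bdry_single, Finset.smul_sum]
    rw [Finset.sum_comm]
    apply Finset.sum_eq_zero
    intro i _
    refine Finset.sum_involution (fun c _ => Function.update c i (!(c i))) ?_ ?_ ?_ ?_
    · intro c _
      have hcard : (-1 : ℚ) ^ (Finset.univ.filter
          (fun j => Function.update c i (!(c i)) j = true)).card
          = - (-1 : ℚ) ^ (Finset.univ.filter (fun j => c j = true)).card := by
        rw [sign_prod, sign_prod, ← Finset.mul_prod_erase _ _ (Finset.mem_univ i),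
          ← Finset.mul_prod_erase _ (fun j => if c j = true then (-1 : ℚ) else 1)
            (Finset.mem_univ i), ← neg_mul]
        congr 1
        · cases h : c i <;> simp
        · apply Finset.prod_congr rfl
          intro j hj
          rw [Function.update_of_ne (Finset.ne_of_mem_erase hj)]
      rw [hcard, neg_smul]
      rw [add_neg_eq_zero]
      congr 2
      apply Subtype.ext
      funext j
      simp only [faceS, selS, Function.comp_apply,
        Function.update_of_ne (Fin.succAbove_ne i j)]
    · intro c _ _ h
      have := congrFun h i
      simp at this
    · intro c _
      exact Finset.mem_univ _
    · intro c _
      simp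

theorem pairing_eval {K : SComplex V} {j : ℕ} (γ : Cochain K j) (hγ) (z : Chain K j) (hz) :
    pairing K j (hcClass K j γ hγ) (hClass K j z hz) = γ z := rfl

theorem dualCoeff_zero {K : SComplex V} {k : ℕ} {σ : Finset V} {s : OSimplex K k}
    (h : ¬ (Function.Injective s.1 ∧ Finset.univ.image s.1 = σ)) :
    dualCoeff K k σ s = 0 := by
  unfold dualCoeff
  rw [dif_neg h]

theorem dualCoeff_pm {K : SComplex V} {k : ℕ} {σ : Finset V} {s : OSimplex K k}
    (h : (Function.Injective s.1 ∧ Finset.univ.image s.1 = σ)) :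
    dualCoeff K k σ s = 1 ∨ dualCoeff K k σ s = -1 := by
  unfold dualCoeff
  rw [dif_pos h]
  simp only
  rcases Int.units_eq_one_or (Equiv.Perm.sign
      ((Equiv.ofBijective
          (fun i : Fin k => (⟨s.1 i, by
            rw [← h.2]; exact Finset.mem_image_of_mem _ (Finset.mem_univ i)⟩ : {x // x ∈ σ}))
          (by
            rw [Fintype.bijective_iff_injective_and_card]
            refine ⟨fun a b hab => h.1 (congrArg Subtype.val hab), ?_⟩
            rw [Fintype.card_coe, ← h.2, Finset.card_image_of_injective _ h.1]
            simp)).trans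
        (Fintype.equivFinOfCardEq (by
            rw [Fintype.card_coe, ← h.2, Finset.card_image_of_injective _ h.1]
            simp)))) with h1 | h1
  · left; rw [h1]; simp
  · right; rw [h1]; simp

theorem dualCoeff_det {K : SComplex V} {k : ℕ} {σ : Finset V}
    (hcard : Fintype.card {x // x ∈ σ} = k) (s : OSimplex K k) :
    dualCoeff K k σ s = Matrix.det (Matrix.of fun i j : Fin k =>
      if s.1 i = ((Fintype.equivFinOfCardEq hcard).symm j : V) then (1 : ℚ) else 0) := by
  by_cases h : (Function.Injective s.1 ∧ Finset.univ.image s.1 = σ)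
  · unfold dualCoeff
    rw [dif_pos h]
    simp only
    rw [← Matrix.det_permutation]
    congr 1
    ext i j
    simp only [PEquiv.toMatrix_apply, Equiv.toPEquiv_apply, Matrix.of_apply, Option.mem_some_iff]
    congr 1
    rw [Equiv.trans_apply, ← Equiv.eq_symm_apply, Equiv.ofBijective_apply, Subtype.ext_iff]
  · rw [dualCoeff_zero h]
    symm
    by_cases hi : Function.Injective s.1
    · have : ∃ i, s.1 i ∉ σ := by
        by_contra hcon
        push Not at hcon
        apply h
        refine ⟨hi, ?_⟩
        apply Finset.eq_of_subset_of_card_le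
        · intro v hv
          obtain ⟨i, -, rfl⟩ := Finset.mem_image.1 hv
          exact hcon i
        · rw [Finset.card_image_of_injective _ hi, ← Fintype.card_coe, hcard]
          simp
      obtain ⟨i, hi⟩ := this
      apply Matrix.det_eq_zero_of_row_eq_zero i
      intro j
      rw [Matrix.of_apply, if_neg]
      intro hh
      apply hi
      rw [hh]
      exact Subtype.property _
    · unfold Function.Injective at hi
      push Not at hi
      obtain ⟨a, b, hab, hne⟩ := hi
      apply Matrix.det_zero_of_row_eq hne
      funext j
      simp only [Matrix.of_apply, hab]

theorem dual_cocycle {G : SimpleGraph V} {k : ℕ} {σ : Finset V} (hd : IsDominating G σ) :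
    dualCochain (indepComplex G) k σ ∈ cocyclesAt (indepComplex G) k := by
  show cobdry _ k _ = 0
  apply Finsupp.lhom_ext'
  intro s
  apply LinearMap.ext_ring
  show dualCochain (indepComplex G) k σ (bdry (indepComplex G) k (Finsupp.single s 1)) = 0
  simp only [bdry_single, map_sum, dual_single]
  by_cases hcard : Fintype.card {x // x ∈ σ} = k
  · by_cases hi : Function.Injective s.1
    · apply Finset.sum_eq_zero
      intro i _
      rw [dualCoeff_zero, mul_zero]
      rintro ⟨-, him⟩
      have himg : ∀ w ∈ σ, ∃ j, s.1 (i.succAbove j) = w := by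
        intro w hw
        rw [← him] at hw
        obtain ⟨j, -, hj⟩ := Finset.mem_image.1 hw
        exact ⟨j, hj⟩
      obtain ⟨w, hw, hwi⟩ := hd (s.1 i)
      obtain ⟨j, rfl⟩ := himg w hw
      rcases hwi with h | h
      · exact Fin.succAbove_ne i j (hi h)
      · exact s.2 _ (Finset.mem_image_of_mem _ (Finset.mem_univ _)) _
          (Finset.mem_image_of_mem _ (Finset.mem_univ _)) h
    · simp only [dualCoeff_det hcard]
      unfold Function.Injective at hi
      push Not at hi
      obtain ⟨a, b, hab, hne⟩ := hi
      let N : Matrix (Fin (k+1)) (Fin (k+1)) ℚ := Matrix.of fun i j =>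
        Fin.cons (α := fun _ => ℚ) 1 (fun j : Fin k =>
          if s.1 i = ((Fintype.equivFinOfCardEq hcard).symm j : V) then (1 : ℚ) else 0) j
      have hN : N.det = 0 := by
        apply Matrix.det_zero_of_row_eq hne
        funext j
        simp only [N, Matrix.of_apply, hab]
      rw [Matrix.det_succ_column_zero] at hN
      refine Eq.trans ?_ hN
      apply Finset.sum_congr rfl
      intro i _
      simp only [N, Matrix.of_apply, Fin.cons_zero, mul_one]
      congr 2
  · apply Finset.sum_eq_zero
    intro i _
    rw [dualCoeff_zero, mul_zero]
    rintro ⟨hi, him⟩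
    apply hcard
    rw [Fintype.card_coe, ← him, Finset.card_image_of_injective _ hi]
    simp

theorem InducedMatching.sel_inj {G : SimpleGraph V} {k : ℕ} (M : InducedMatching G k)
    (c d : Fin k → Bool) (i j : Fin k)
    (h : (if c i then M.snd i else M.fst i) = (if d j then M.snd j else M.fst j)) :
    i = j ∧ c i = d j := by
  have hij : i = j := by
    by_contra hne
    obtain ⟨h1, h2, h3, h4⟩ := M.disjoint i j hne
    by_cases hc : c i <;> by_cases hd : d j <;> simp_all
  subst hij
  refine ⟨rfl, ?_⟩
  have := (M.adj i).ne
  by_cases hc : c i <;> by_cases hd : d i <;> simp_all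

theorem dual_eval {G : SimpleGraph V} {k : ℕ} (M : InducedMatching G k) (σ : Finset V) :
    dualCochain (indepComplex G) k σ M.matchingChain = 0 ∨
    ∃ c : Fin k → Bool, Finset.univ.image (fun i => if c i then M.snd i else M.fst i) = σ := by
  by_cases h : ∃ c : Fin k → Bool,
      Finset.univ.image (fun i => if c i then M.snd i else M.fst i) = σ
  · exact Or.inr h
  · left
    rw [matchingChain_eq, map_sum]
    apply Finset.sum_eq_zero
    intro c _
    rw [map_smul, dual_single, dualCoeff_zero]
    · simp
    · rintro ⟨-, h2⟩
      exact h ⟨c, h2⟩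

theorem dual_eval_pm {G : SimpleGraph V} {k : ℕ} (M : InducedMatching G k) (σ : Finset V)
    (c : Fin k → Bool) (hc : Finset.univ.image (fun i => if c i then M.snd i else M.fst i) = σ) :
    dualCochain (indepComplex G) k σ M.matchingChain = 1 ∨
    dualCochain (indepComplex G) k σ M.matchingChain = -1 := by
  rw [matchingChain_eq, map_sum, Finset.sum_eq_single c]
  · rw [map_smul, dual_single]
    have := dualCoeff_pm (K := indepComplex G) (σ := σ)
      (s := selS M c)
      ⟨fun i j h => (M.sel_inj c c i j h).1, hc⟩
    rcases neg_one_pow_eq_or ℚ (Finset.univ.filter (fun i => c i = true)).card with h1 | h1 <;>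
    rcases this with h2 | h2 <;> rw [h1, h2] <;> simp
  · intro d _ hne
    rw [map_smul, dual_single, dualCoeff_zero]
    · simp
    · rintro ⟨-, h2⟩
      apply hne
      funext i
      have : (if d i then M.snd i else M.fst i) ∈ σ := by
        rw [← h2]; exact Finset.mem_image_of_mem _ (Finset.mem_univ i)
      rw [← hc] at this
      obtain ⟨j, -, hj⟩ := Finset.mem_image.1 this
      obtain ⟨h3, h4⟩ := M.sel_inj c d j i hj
      subst h3
      exact h4.symm
  · intro h; exact absurd (Finset.mem_univ _) h

/-- The set of first endpoints. -/
def matchSet {G : SimpleGraph V} {k : ℕ} (M : InducedMatching G k) : Finset V :=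
  Finset.univ.image M.fst

theorem mem_matchSet {G : SimpleGraph V} {k : ℕ} (M : InducedMatching G k) (v : V) :
    v ∈ matchSet M ↔ ∃ i, M.fst i = v := by
  simp [matchSet]

theorem matchSet_trans {G : SimpleGraph V} {k : ℕ} (M : InducedMatching G k) :
    M.IsTransversal (matchSet M) := by
  refine ⟨Finset.subset_union_left, fun i => Or.inl ⟨(mem_matchSet _ _).2 ⟨i, rfl⟩, ?_⟩⟩
  intro hm
  obtain ⟨j, hj⟩ := (mem_matchSet _ _).1 hm
  by_cases hij : i = j
  · subst hij
    exact (M.adj i).ne hj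
  · exact (M.disjoint i j hij).2.2.1 hj.symm

theorem dual_eval_zero {G : SimpleGraph V} {k : ℕ} (M N : InducedMatching G k) (i : Fin k)
    (h1 : ∀ j, M.fst j ≠ N.fst i) (h2 : ∀ j, M.snd j ≠ N.fst i) :
    dualCochain (indepComplex G) k (matchSet N) M.matchingChain = 0 := by
  rcases dual_eval M (matchSet N) with h | ⟨c, hc⟩
  · exact h
  · exfalso
    have hm := (mem_matchSet N _).2 ⟨i, rfl⟩
    rw [← hc] at hm
    obtain ⟨j, -, hj⟩ := Finset.mem_image.1 hm
    by_cases hcj : c j = true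
    · rw [if_pos hcj] at hj
      exact h2 _ hj
    · rw [if_neg hcj] at hj
      exact h1 _ hj

theorem dual_eval_one {G : SimpleGraph V} {k : ℕ} (M N : InducedMatching G k)
    (c : Fin k → Bool) (hc : ∀ i, (if c i then M.snd i else M.fst i) = N.fst i) :
    dualCochain (indepComplex G) k (matchSet N) M.matchingChain = 1 ∨
    dualCochain (indepComplex G) k (matchSet N) M.matchingChain = -1 := by
  apply dual_eval_pm _ _ c
  rw [funext hc]
  rfl

theorem triangular_indep {W : Type*} [AddCommGroup W] [Module ℚ W] {k : ℕ}
    (a : (Fin k → Bool) → W) (f : (Fin k → Bool) → W →ₗ[ℚ] ℚ)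
    (h0 : ∀ s t, (∃ i, t i = true ∧ s i = false) → f t (a s) = 0)
    (h1 : ∀ t, f t (a t) = 1 ∨ f t (a t) = -1) : LinearIndependent ℚ a := by
  rw [Fintype.linearIndependent_iff]
  intro g hg t
  induction t using WellFoundedGT.induction with
  | ind t ih =>
    have := congrArg (f t) hg
    rw [map_sum, map_zero, Finset.sum_eq_single t] at this
    · rw [map_smul, smul_eq_mul] at this
      rcases h1 t with h | h <;> rw [h] at this <;> simpa using this
    · intro s _ hne
      by_cases h : ∃ i, t i = true ∧ s i = false
      · rw [map_smul, h0 s t h, smul_zero]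
      · rw [ih s, zero_smul, map_zero]
        refine lt_of_le_of_ne ?_ hne.symm
        intro i
        push Not at h
        have := h i
        cases ht : t i <;> cases hs : s i <;> simp_all
    · intro h; exact absurd (Finset.mem_univ _) h

end Hom
section Local

attribute [-instance] Classical.propDecidable

/-- Generators of the Kagome adjacency: source label, target label, cell displacement. -/
def kgen : List (Fin 6 × Fin 6 × ℤ × ℤ) :=
  [(0, 1, 0, 0), (1, 0, 1, 0), (3, 4, 0, 0), (4, 3, 1, 0),
   (2, 0, 0, 0), (2, 1, 0, 0), (2, 3, 0, 0), (2, 4, 0, 0),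
   (5, 4, 0, 0), (5, 3, 1, 0), (5, 1, 0, 1), (5, 0, 1, 1)]

/-- The position (relative to the tile origin) of the vertex on side `c` of the edge `e` of the
configuration `b`; side `false` is the transversal. -/
def kpos : Bool → Bool → Fin 8 → ℤ × ℤ × Fin 6
  | false, false => ![(-1, 0, 1), (-1, 0, 5), (0, -1, 4), (1, 1, 0), (1, -1, 5), (2, 0, 3),
      (0, 0, 2), (1, 0, 2)]
  | true, false => ![(-1, 0, 1), (-1, 0, 5), (0, -1, 4), (1, 1, 0), (1, -1, 5), (2, 0, 3),
      (0, 0, 1), (1, 0, 3)]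
  | false, true => ![(-1, -1, 5), (-1, 0, 4), (1, -1, 3), (0, 1, 1), (2, 0, 0), (1, 0, 5),
      (0, 0, 4), (1, 0, 0)]
  | true, true => ![(-1, -1, 5), (-1, 0, 4), (1, -1, 3), (0, 1, 1), (2, 0, 0), (1, 0, 5),
      (0, 0, 2), (1, 0, 2)]

/-- Local adjacency (directed). -/
def locRel (p p' : ℤ × ℤ × Fin 6) : Prop :=
  ∃ g ∈ kgen, p.2.2 = g.1 ∧ p'.2.2 = g.2.1 ∧ p'.1 = p.1 + g.2.2.1 ∧ p'.2.1 = p.2.1 + g.2.2.2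

instance (p p' : ℤ × ℤ × Fin 6) : Decidable (locRel p p') := by
  unfold locRel; infer_instance

theorem chk_eq : ∀ b c e b' c' e', (kpos b c e).2.2 = (kpos b' c' e').2.2 →
    ((kpos b c e).1 + 3 * (kpos b c e).2.1
      - ((kpos b' c' e').1 + 3 * (kpos b' c' e').2.1)) % 6 = 0 →
    kpos b c e = kpos b' c' e' := by decide +kernel

theorem chk_rel : ∀ b c e b' c' e', ∀ g ∈ kgen, (kpos b c e).2.2 = g.1 →
    (kpos b' c' e').2.2 = g.2.1 →
    ((kpos b' c' e').1 + 3 * (kpos b' c' e').2.1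
      - ((kpos b c e).1 + g.2.2.1 + 3 * ((kpos b c e).2.1 + g.2.2.2))) % 6 = 0 →
    (kpos b' c' e').1 = (kpos b c e).1 + g.2.2.1 ∧
    (kpos b' c' e').2.1 = (kpos b c e).2.1 + g.2.2.2 := by decide +kernel

theorem chk_ind : ∀ b c e c' e', e ≠ e' → ¬ locRel (kpos b c e) (kpos b c' e') ∧
    kpos b c e ≠ kpos b c' e' := by decide +kernel

theorem chk_adj : ∀ b e, locRel (kpos b false e) (kpos b true e) ∨
    locRel (kpos b true e) (kpos b false e) := by decide +kernel

theorem chk_dom : ∀ r l : Fin 6, ∃ i : Fin 9, ∃ j : Fin 9,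
    ((r : ℤ) - (((i : ℤ) - 4) + 3 * ((j : ℤ) - 4))) % 6 = 0 ∧
    ∀ b, ∃ e, kpos b false e = ((i : ℤ) - 4, (j : ℤ) - 4, l) ∨
      locRel (kpos b false e) ((i : ℤ) - 4, (j : ℤ) - 4, l) ∨
      locRel ((i : ℤ) - 4, (j : ℤ) - 4, l) (kpos b false e) := by decide +kernel

theorem chk_sub : ∀ b b' e, (b = true → b' = true) → ∃ c, kpos b' c e = kpos b false e := by
  decide +kernel

theorem chk_nsub : ∀ c e, kpos true false 6 ≠ kpos false c e := by decide +kernel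

theorem chk_lab : ∀ g ∈ kgen, g.1 ≠ g.2.1 := by decide +kernel

end Local

section Abs

variable {X : Type u} [AddCommGroup X]

/-- Abstract Kagome relation. -/
def absRel (e1 e2 : X) (x y : X × Fin 6) : Prop :=
  ∃ g ∈ kgen, x.2 = g.1 ∧ y.2 = g.2.1 ∧ y.1 = x.1 + (g.2.2.1 • e1 + g.2.2.2 • e2)

/-- Placing a local position at a tile origin. -/
def place (e1 e2 : X) (o : X) (p : ℤ × ℤ × Fin 6) : X × Fin 6 :=
  (o + (p.1 • e1 + p.2.1 • e2), p.2.2)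

theorem chi_aux {e1 e2 : X} {χ : X →+ ZMod 6} (h1 : χ e1 = 1) (h2 : χ e2 = 3) (i j : ℤ) :
    χ (i • e1 + j • e2) = ((i + 3 * j : ℤ) : ZMod 6) := by
  rw [map_add, map_zsmul, map_zsmul, h1, h2]
  push_cast
  simp [mul_comm]

theorem cast_aux {a b : ℤ} (h : (a : ZMod 6) = (b : ZMod 6)) : (a - b) % 6 = 0 := by
  have := (ZMod.intCast_eq_intCast_iff_dvd_sub b a 6).1 h.symm
  exact Int.emod_eq_zero_of_dvd this

theorem cast_aux' {a b : ℤ} (h : (a - b) % 6 = 0) : (a : ZMod 6) = (b : ZMod 6) := by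
  exact ((ZMod.intCast_eq_intCast_iff_dvd_sub b a 6).2 (Int.dvd_of_emod_eq_zero h)).symm

theorem place_eq {e1 e2 : X} {χ : X →+ ZMod 6} (h1 : χ e1 = 1) (h2 : χ e2 = 3)
    {o o' : X} (ho : χ o = 0) (ho' : χ o' = 0) {b c e b' c' e'}
    (h : place e1 e2 o (kpos b c e) = place e1 e2 o' (kpos b' c' e')) :
    o = o' ∧ kpos b c e = kpos b' c' e' := by
  have hl := congrArg Prod.snd h
  have hx := congrArg Prod.fst h
  simp only [place] at hl hx
  have hχ := congrArg χ hx
  rw [map_add χ o, map_add χ o', ho, ho', zero_add, zero_add, chi_aux h1 h2, chi_aux h1 h2] at hχ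
  have := chk_eq b c e b' c' e' hl (cast_aux hχ)
  refine ⟨?_, this⟩
  rw [this] at hx
  exact add_right_cancel hx

theorem place_rel {e1 e2 : X} {χ : X →+ ZMod 6} (h1 : χ e1 = 1) (h2 : χ e2 = 3)
    {o o' : X} (ho : χ o = 0) (ho' : χ o' = 0) {b c e b' c' e'}
    (h : absRel e1 e2 (place e1 e2 o (kpos b c e)) (place e1 e2 o' (kpos b' c' e'))) :
    o = o' ∧ locRel (kpos b c e) (kpos b' c' e') := by
  obtain ⟨g, hg, hl, hl', hx⟩ := h
  simp only [place] at hl hl' hx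
  have hx2 : o' + ((kpos b' c' e').1 • e1 + (kpos b' c' e').2.1 • e2) =
      o + (((kpos b c e).1 + g.2.2.1) • e1 + ((kpos b c e).2.1 + g.2.2.2) • e2) := by
    rw [hx, add_smul, add_smul]; abel
  have hχ := congrArg χ hx2
  rw [map_add χ o, map_add χ o', ho, ho', zero_add, zero_add, chi_aux h1 h2, chi_aux h1 h2] at hχ
  have := chk_rel b c e b' c' e' g hg hl hl' (cast_aux hχ)
  refine ⟨?_, g, hg, hl, hl', this.1, this.2⟩
  rw [this.1, this.2] at hx2
  exact (add_right_cancel hx2).symm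

theorem rel_place {e1 e2 : X} {o : X} {p p' : ℤ × ℤ × Fin 6} (h : locRel p p') :
    absRel e1 e2 (place e1 e2 o p) (place e1 e2 o p') := by
  obtain ⟨g, hg, hl, hl', h3, h4⟩ := h
  refine ⟨g, hg, hl, hl', ?_⟩
  simp only [place, h3, h4, add_smul]
  abel

/-- The matching associated to a sequence of configurations. -/
def absM {e1 e2 : X} {χ : X →+ ZMod 6} (h1 : χ e1 = 1) (h2 : χ e2 = 3)
    {G : SimpleGraph (X × Fin 6)}
    (hG : ∀ x y, G.Adj x y ↔ absRel e1 e2 x y ∨ absRel e1 e2 y x) {k : ℕ}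
    (T : Fin k ≃ {o : X // χ o = 0}) (s : Fin k → Bool) : InducedMatching G (8 * k) where
  fst i := place e1 e2 (T (finProdFinEquiv.symm i).2)
    (kpos (s (finProdFinEquiv.symm i).2) false (finProdFinEquiv.symm i).1)
  snd i := place e1 e2 (T (finProdFinEquiv.symm i).2)
    (kpos (s (finProdFinEquiv.symm i).2) true (finProdFinEquiv.symm i).1)
  adj i := by
    rw [hG]
    exact (chk_adj _ _).imp rel_place rel_place
  disjoint i j hij := by
    have key : ∀ c c', place e1 e2 (T (finProdFinEquiv.symm i).2 : X)
        (kpos (s (finProdFinEquiv.symm i).2) c (finProdFinEquiv.symm i).1) ≠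
        place e1 e2 (T (finProdFinEquiv.symm j).2 : X)
        (kpos (s (finProdFinEquiv.symm j).2) c' (finProdFinEquiv.symm j).1) := by
      intro c c' h
      obtain ⟨h3, h4⟩ := place_eq h1 h2 (T _).2 (T _).2 h
      have h5 : (finProdFinEquiv.symm i).2 = (finProdFinEquiv.symm j).2 :=
        T.injective (Subtype.ext h3)
      rw [h5] at h4
      refine (chk_ind _ _ _ _ _ ?_).2 h4
      intro h6
      exact hij (finProdFinEquiv.symm.injective (Prod.ext h6 h5))
    exact ⟨key _ _, key _ _, key _ _, key _ _⟩
  induced i j hij := by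
    have key : ∀ i j, i ≠ j → ∀ c c', ¬ absRel e1 e2 (place e1 e2 (T (finProdFinEquiv.symm i).2 : X)
        (kpos (s (finProdFinEquiv.symm i).2) c (finProdFinEquiv.symm i).1))
        (place e1 e2 (T (finProdFinEquiv.symm j).2 : X)
        (kpos (s (finProdFinEquiv.symm j).2) c' (finProdFinEquiv.symm j).1)) := by
      intro i j hij c c' h
      obtain ⟨h3, h4⟩ := place_rel h1 h2 (T _).2 (T _).2 h
      have h5 : (finProdFinEquiv.symm i).2 = (finProdFinEquiv.symm j).2 :=
        T.injective (Subtype.ext h3)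
      rw [h5] at h4
      refine (chk_ind _ _ _ _ _ ?_).1 h4
      intro h6
      exact hij (finProdFinEquiv.symm.injective (Prod.ext h6 h5))
    simp only [hG, not_or]
    exact ⟨⟨key _ _ hij _ _, key _ _ hij.symm _ _⟩, ⟨key _ _ hij _ _, key _ _ hij.symm _ _⟩,
      ⟨key _ _ hij _ _, key _ _ hij.symm _ _⟩, ⟨key _ _ hij _ _, key _ _ hij.symm _ _⟩⟩

theorem main_abs {e1 e2 : X} {χ : X →+ ZMod 6} (h1 : χ e1 = 1) (h2 : χ e2 = 3)
    {G : SimpleGraph (X × Fin 6)}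
    (hG : ∀ x y, G.Adj x y ↔ absRel e1 e2 x y ∨ absRel e1 e2 y x) {k : ℕ}
    (T : Fin k ≃ {o : X // χ o = 0}) :
    ∃ (M : (Fin k → Bool) → InducedMatching G (8 * k))
      (σ : (Fin k → Bool) → Finset (X × Fin 6)),
      (∀ s, (M s).IsTransversal (σ s) ∧ IsDominating G (σ s)) ∧
      ∃ (hz : ∀ s, (M s).matchingChain ∈ SComplex.cyclesAt (indepComplex G) (8 * k))
        (hc : ∀ t, SComplex.dualCochain (indepComplex G) (8 * k) (σ t) ∈
            SComplex.cocyclesAt (indepComplex G) (8 * k)),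
        (∀ s t, (∃ i, t i = true ∧ s i = false) →
          SComplex.pairing (indepComplex G) (8 * k)
            (SComplex.hcClass _ _ _ (hc t)) (SComplex.hClass _ _ _ (hz s)) = 0) ∧
        (∀ s t, ¬ (∃ i, t i = true ∧ s i = false) →
          (SComplex.pairing (indepComplex G) (8 * k)
            (SComplex.hcClass _ _ _ (hc t)) (SComplex.hClass _ _ _ (hz s)) = 1 ∨
           SComplex.pairing (indepComplex G) (8 * k)
            (SComplex.hcClass _ _ _ (hc t)) (SComplex.hClass _ _ _ (hz s)) = -1)) ∧
        LinearIndependent ℚ (fun s : Fin k → Bool =>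
          SComplex.hClass (indepComplex G) (8 * k) (M s).matchingChain (hz s)) := by
  have hdom : ∀ s : Fin k → Bool,
      IsDominating G (matchSet (absM h1 h2 hG T s)) := by
    intro s v
    obtain ⟨x, l⟩ := v
    obtain ⟨i, j, hr, hb⟩ := chk_dom (χ x) l
    set I : ℤ := (i : ℤ) - 4
    set J : ℤ := (j : ℤ) - 4
    have ho : χ (x - (I • e1 + J • e2)) = 0 := by
      rw [map_sub, chi_aux h1 h2, ← cast_aux' hr, sub_eq_zero]
      generalize χ x = r
      revert r
      decide
    have hpl : ∀ t, (T t : X) = x - (I • e1 + J • e2) →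
        place e1 e2 (T t : X) (I, J, l) = (x, l) := by
      intro t ht
      simp only [place, ht, sub_add_cancel]
    obtain ⟨t, ht⟩ := T.surjective ⟨_, ho⟩
    have ht' := congrArg Subtype.val ht
    have hpl := hpl t ht'
    obtain ⟨e, he⟩ := hb (s t)
    refine ⟨(absM h1 h2 hG T s).fst (finProdFinEquiv (e, t)),
      (mem_matchSet _ _).2 ⟨_, rfl⟩, ?_⟩
    rw [hG]
    simp only [absM, Equiv.symm_apply_apply]
    rw [← hpl]
    rcases he with he | he | he
    · left; rw [he]
    · right; left; exact rel_place he
    · right; right; exact rel_place he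
  have hp0 : ∀ s t : Fin k → Bool, (∃ i, t i = true ∧ s i = false) →
      SComplex.dualCochain (indepComplex G) (8 * k) (matchSet (absM h1 h2 hG T t))
        (absM h1 h2 hG T s).matchingChain = 0 := by
    rintro s t ⟨i, hti, hsi⟩
    have key : ∀ j d, place e1 e2 (T (finProdFinEquiv.symm j).2 : X)
        (kpos (s (finProdFinEquiv.symm j).2) d (finProdFinEquiv.symm j).1) ≠
        (absM h1 h2 hG T t).fst (finProdFinEquiv (6, i)) := by
      intro j d h
      simp only [absM, Equiv.symm_apply_apply] at h
      obtain ⟨h3, h4⟩ := place_eq h1 h2 (T _).2 (T _).2 h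
      have h5 : (finProdFinEquiv.symm j).2 = i := T.injective (Subtype.ext h3)
      rw [h5, hti, hsi] at h4
      exact chk_nsub _ _ h4.symm
    exact dual_eval_zero _ _ (finProdFinEquiv (6, i)) (fun j => key j _) (fun j => key j _)
  have hp1 : ∀ s t : Fin k → Bool, ¬ (∃ i, t i = true ∧ s i = false) →
      SComplex.dualCochain (indepComplex G) (8 * k) (matchSet (absM h1 h2 hG T t))
        (absM h1 h2 hG T s).matchingChain = 1 ∨
      SComplex.dualCochain (indepComplex G) (8 * k) (matchSet (absM h1 h2 hG T t))
        (absM h1 h2 hG T s).matchingChain = -1 := by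
    intro s t h
    have hsub : ∀ i : Fin (8 * k), ∃ c,
        kpos (s (finProdFinEquiv.symm i).2) c (finProdFinEquiv.symm i).1 =
        kpos (t (finProdFinEquiv.symm i).2) false (finProdFinEquiv.symm i).1 := by
      intro i
      apply chk_sub
      intro hti
      by_contra hsi
      exact h ⟨_, hti, by simpa using hsi⟩
    choose c hc using hsub
    apply dual_eval_one _ _ c
    intro i
    by_cases hci : c i = true
    · rw [if_pos hci]
      have := hc i
      rw [hci] at this
      simp only [absM, this]
    · rw [if_neg hci]
      have := hc i
      rw [Bool.not_eq_true] at hci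
      rw [hci] at this
      simp only [absM, this]
  refine ⟨fun s => absM h1 h2 hG T s, fun s => matchSet (absM h1 h2 hG T s),
    fun s => ⟨matchSet_trans _, hdom s⟩,
    fun s => matchingChain_cycle _, fun t => dual_cocycle (hdom t), hp0, hp1, ?_⟩
  · exact triangular_indep _
      (fun t => SComplex.pairing (indepComplex G) (8 * k)
            (SComplex.hcClass _ _ _ (dual_cocycle (hdom t)))) hp0
      (fun t => hp1 t t (by rintro ⟨i, h3, h4⟩; rw [h3] at h4; exact absurd h4 (by simp)))

end Abs

section Conc

/-- The residue homomorphism on cells. -/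
def kchi (n q : ℕ) (h6 : 6 ∣ n + 1) (h2 : 2 ∣ q + 1) : Fin (n + 1) × Fin (q + 1) →+ ZMod 6 where
  toFun x := ((x.1 : ℕ) : ZMod 6) + ((3 * (x.2 : ℕ) : ℕ) : ZMod 6)
  map_zero' := by simp
  map_add' x y := by
    have ha : (((x.1 + y.1 : Fin (n + 1)) : ℕ) : ZMod 6) = (((x.1 : ℕ) + (y.1 : ℕ) : ℕ) : ZMod 6) := by
      rw [ZMod.natCast_eq_natCast_iff, Fin.val_add]
      exact (Nat.mod_modEq _ _).of_dvd h6
    have hb : ((3 * ((x.2 + y.2 : Fin (q + 1)) : ℕ) : ℕ) : ZMod 6)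
        = ((3 * ((x.2 : ℕ) + (y.2 : ℕ)) : ℕ) : ZMod 6) := by
      rw [ZMod.natCast_eq_natCast_iff, Fin.val_add]
      exact Nat.ModEq.mul_left' 3 ((Nat.mod_modEq _ _).of_dvd h2)
    rw [Prod.fst_add, Prod.snd_add, ha, hb]
    push_cast
    ring

theorem kchi_e1 (n q : ℕ) (h6 : 6 ∣ n + 1) (h2 : 2 ∣ q + 1) : kchi n q h6 h2 (1, 0) = 1 := by
  have : 1 % (n + 1) = 1 := Nat.mod_eq_of_lt (by omega)
  simp [kchi, this]

theorem kchi_e2 (n q : ℕ) (h6 : 6 ∣ n + 1) (h2 : 2 ∣ q + 1) : kchi n q h6 h2 (0, 1) = 3 := by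
  have : 1 % (q + 1) = 1 := Nat.mod_eq_of_lt (by omega)
  simp [kchi, this]

theorem kagome_tiles (n q : ℕ) (h6 : 6 ∣ n + 1) (h2 : 2 ∣ q + 1) (k : ℕ)
    (hk : k * 6 = (n + 1) * (q + 1)) :
    Nonempty (Fin k ≃ {o : Fin (n + 1) × Fin (q + 1) // kchi n q h6 h2 o = 0}) := by
  let f : {o : Fin (n + 1) × Fin (q + 1) // kchi n q h6 h2 o = 0} × ZMod 6 ≃
      Fin (n + 1) × Fin (q + 1) :=
    { toFun := fun p => p.1.1 + p.2.val • (1, 0)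
      invFun := fun x => (⟨x - (kchi n q h6 h2 x).val • (1, 0), by
        rw [map_sub, map_nsmul, kchi_e1]; simp⟩, kchi n q h6 h2 x)
      left_inv := by
        rintro ⟨⟨o, ho⟩, r⟩
        have : kchi n q h6 h2 (o + r.val • (1, 0)) = r := by
          rw [map_add, ho, map_nsmul, kchi_e1]; simp
        refine Prod.ext (Subtype.ext ?_) this
        show o + r.val • (1, 0) - (kchi n q h6 h2 (o + r.val • (1, 0))).val • (1, 0) = o
        rw [this, add_sub_cancel_right]
      right_inv := by
        intro x
        simp }
  have hc := Fintype.card_congr f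
  rw [Fintype.card_prod, ZMod.card, Fintype.card_prod, Fintype.card_fin, Fintype.card_fin, ← hk] at hc
  refine ⟨(Fintype.equivFinOfCardEq ?_).symm⟩
  omega

theorem finSucc_iff {n : ℕ} (i i' : Fin (n + 1)) : finSucc i i' ↔ i' = i + 1 := by
  unfold finSucc
  rw [Fin.ext_iff, Fin.val_add, Fin.val_one', Nat.add_mod_mod]

theorem kagomeRel_iff (n q : ℕ) (x y : (Fin (n + 1) × Fin (q + 1)) × Fin 6) :
    kagomeRel (n + 1) (q + 1) x y ↔ absRel (1, 0) (0, 1) x y := by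
  obtain ⟨⟨a, b⟩, l⟩ := x
  obtain ⟨⟨a', b'⟩, l'⟩ := y
  simp only [kagomeRel, finSucc_iff]
  constructor
  · rintro (⟨rfl, rfl, h⟩ | ⟨rfl, rfl, rfl, rfl⟩ | ⟨rfl, rfl, h⟩ | ⟨rfl, rfl, rfl, rfl⟩ |
      ⟨rfl, (rfl | rfl | rfl | rfl), h⟩ |
      ⟨rfl, (⟨rfl, h⟩ | ⟨rfl, rfl, rfl⟩ | ⟨rfl, rfl, rfl⟩ | ⟨rfl, rfl, rfl⟩)⟩)
    · exact ⟨(0, 1, 0, 0), by simp [kgen], rfl, rfl, by simp [h]⟩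
    · exact ⟨(1, 0, 1, 0), by simp [kgen], rfl, rfl, by simp⟩
    · exact ⟨(3, 4, 0, 0), by simp [kgen], rfl, rfl, by simp [h]⟩
    · exact ⟨(4, 3, 1, 0), by simp [kgen], rfl, rfl, by simp⟩
    · exact ⟨(2, 0, 0, 0), by simp [kgen], rfl, rfl, by simp [h]⟩
    · exact ⟨(2, 1, 0, 0), by simp [kgen], rfl, rfl, by simp [h]⟩
    · exact ⟨(2, 3, 0, 0), by simp [kgen], rfl, rfl, by simp [h]⟩
    · exact ⟨(2, 4, 0, 0), by simp [kgen], rfl, rfl, by simp [h]⟩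
    · exact ⟨(5, 4, 0, 0), by simp [kgen], rfl, rfl, by simp [h]⟩
    · exact ⟨(5, 3, 1, 0), by simp [kgen], rfl, rfl, by simp⟩
    · exact ⟨(5, 1, 0, 1), by simp [kgen], rfl, rfl, by simp⟩
    · exact ⟨(5, 0, 1, 1), by simp [kgen], rfl, rfl, by simp⟩
  · rintro ⟨g, hg, h1, h2, h3⟩
    simp only [kgen, List.mem_cons, List.not_mem_nil, or_false] at hg
    simp only at h1 h2 h3
    rcases hg with rfl | rfl | rfl | rfl | rfl | rfl | rfl | rfl | rfl | rfl | rfl | rfl <;>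
      simp only at h1 h2 h3 <;> subst h1 h2 <;>
      simp only [zero_smul, one_smul, add_zero, zero_add, Prod.mk_add_mk, Prod.mk.injEq] at h3 <;>
      obtain ⟨h3, h4⟩ := h3 <;> simp [h3, h4]

theorem kagome_adj (n q : ℕ) (x y : (Fin (n + 1) × Fin (q + 1)) × Fin 6) :
    (kagomeAux (n + 1) (q + 1)).Adj x y ↔
      absRel (1, 0) (0, 1) x y ∨ absRel (1, 0) (0, 1) y x := by
  unfold kagomeAux
  rw [SimpleGraph.fromRel_adj, kagomeRel_iff, kagomeRel_iff]
  refine ⟨fun h => h.2, fun h => ⟨?_, h⟩⟩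
  rintro rfl
  rcases h with h | h <;> obtain ⟨g, hg, h1, h2, -⟩ := h <;>
    exact chk_lab g hg (h1.symm.trans h2)

end Conc

/-- Let `ℍ = ℍ_{n,m}` be a finite quotient of the Kagome lattice tiled by
`k = v(ℍ)/36` large hexagonal tiles (`6 ∣ n`, `4 ∣ m`).  Each tile admits two
configurations `A` (encoded `false`) and `B` (encoded `true`), each an induced matching
of `8` edges with a transversal.  For every sequence `s ∈ {A,B}^k` the union `M(s)` of
the chosen matchings is an induced matching of size `8k` in `ℍ` whose chosen transversal
`σ(s)` is dominating; for any two sequences `s, t` the pairing `⟨σ(t)^∨, α_{M(s)}⟩`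
vanishes whenever `t i = B` and `s i = A` for some tile `i`, and equals `±1` otherwise;
consequently the `2^k` classes `α_{M(s)} ∈ H̃_{8k-1}(I(ℍ); ℚ)` are linearly
independent. -/
theorem statement6 (n m : ℕ) (hn : 0 < n) (hm : 0 < m) (h6 : 6 ∣ n) (h4 : 4 ∣ m) :
    ∃ (M : (Fin (3 * n * m / 36) → Bool) →
        InducedMatching (kagomeGraph n m) (8 * (3 * n * m / 36)))
      (σ : (Fin (3 * n * m / 36) → Bool) → Finset ((Fin n × Fin (m / 2)) × Fin 6)),
      (∀ s, (M s).IsTransversal (σ s) ∧ IsDominating (kagomeGraph n m) (σ s)) ∧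
      ∃ (hz : ∀ s, (M s).matchingChain ∈
            SComplex.cyclesAt (indepComplex (kagomeGraph n m)) (8 * (3 * n * m / 36)))
        (hc : ∀ t, SComplex.dualCochain (indepComplex (kagomeGraph n m))
            (8 * (3 * n * m / 36)) (σ t) ∈
            SComplex.cocyclesAt (indepComplex (kagomeGraph n m)) (8 * (3 * n * m / 36))),
        (∀ s t, (∃ i, t i = true ∧ s i = false) →
          SComplex.pairing (indepComplex (kagomeGraph n m)) (8 * (3 * n * m / 36))
            (SComplex.hcClass _ _ _ (hc t)) (SComplex.hClass _ _ _ (hz s)) = 0) ∧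
        (∀ s t, ¬ (∃ i, t i = true ∧ s i = false) →
          (SComplex.pairing (indepComplex (kagomeGraph n m)) (8 * (3 * n * m / 36))
            (SComplex.hcClass _ _ _ (hc t)) (SComplex.hClass _ _ _ (hz s)) = 1 ∨
           SComplex.pairing (indepComplex (kagomeGraph n m)) (8 * (3 * n * m / 36))
            (SComplex.hcClass _ _ _ (hc t)) (SComplex.hClass _ _ _ (hz s)) = -1)) ∧
        LinearIndependent ℚ (fun s : Fin (3 * n * m / 36) → Bool =>
          SComplex.hClass (indepComplex (kagomeGraph n m)) (8 * (3 * n * m / 36))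
            (M s).matchingChain (hz s)) := by
  have : n = (n - 1) + 1 := by omega
  obtain ⟨n, rfl⟩ : ∃ n', n = n' + 1 := ⟨n - 1, by omega⟩
  obtain ⟨r, rfl⟩ := h4
  have hq : 4 * r / 2 = (2 * r - 1) + 1 := by omega
  have hq2 : 2 ∣ (2 * r - 1) + 1 := by omega
  unfold kagomeGraph
  have hcount : (3 * (n + 1) * (4 * r) / 36) * 6 = (n + 1) * ((2 * r - 1) + 1) := by
    obtain ⟨a, ha⟩ := h6
    rw [ha, show 2 * r - 1 + 1 = 2 * r by omega,
      show 3 * (6 * a) * (4 * r) = 36 * (2 * (a * r)) by ring, Nat.mul_div_cancel_left _ (by omega)]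
    ring
  rw [hq]
  generalize 2 * r - 1 = q at *
  obtain ⟨T⟩ := kagome_tiles n q h6 hq2 _ hcount
  exact main_abs (kchi_e1 n q h6 hq2) (kchi_e2 n q h6 hq2) (kagome_adj n q) T
end
end

section
/- Let (M, σ) be an induced matching of size k with a dominating transversal in a finite simple graph G, and let j : I(M) → I(G) be the embedding of independence complexes induced by the inclusion M ↪ G. Then there is a homotopy equivalence I(G) ≃ I(M) ∨ C(j), where C(j) denotes the homotopy cofibre of j and I(M) is the sphere S^{k-1}. -/
attribute [local instance] Classical.propDecidable

noncomputable section

open Finset Module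
open scoped DirectSum

universe u

section Topology

open SComplex

variable {V : Type u}

/-- The geometric realization of a simplicial complex on a finite vertex set: the space of
convex weightings of the vertices whose support is a face.  (The realization of the empty
complex, which has only the empty face, is the empty space `S^{-1}`.) -/
def realization [Fintype V] (K : SComplex V) : Type u :=
  {f : V → ℝ // (∀ v, 0 ≤ f v) ∧ (∑ v, f v) = 1 ∧
    Finset.univ.filter (fun v => f v ≠ 0) ∈ K.faces}

instance realizationTopology [Fintype V] (K : SComplex V) :
    TopologicalSpace (realization K) := by
  unfold realization; infer_instance

/-- The induced subcomplex `K[U]` of `K` on a vertex subset `U` (kept on the ambient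
vertex type). -/
def inducedSub (K : SComplex V) (U : Set V) : SComplex V where
  faces := {s | s ∈ K.faces ∧ ∀ v ∈ s, v ∈ U}
  empty_mem := ⟨K.empty_mem, by simp⟩
  down_closed := by
    rintro s t ⟨hs, hsU⟩ hts
    exact ⟨K.down_closed hs hts, fun v hv => hsU v (hts hv)⟩

/-- The continuous inclusion of the realization of a subcomplex. -/
def inclMap [Fintype V] {K L : SComplex V} (h : K.faces ⊆ L.faces) :
    C(realization K, realization L) :=
  ⟨fun p => ⟨p.1, p.2.1, p.2.2.1, h p.2.2.2⟩,
    Continuous.subtype_mk continuous_subtype_val _⟩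

/-- The relation generated by gluing in a mapping cone: the base of the cylinder is glued
along `f` and the top of the cylinder is collapsed to a point. -/
inductive coneRel {A X : Type u} (f : A → X) :
    (A × unitInterval) ⊕ X → (A × unitInterval) ⊕ X → Prop
  | base (a : A) : coneRel f (Sum.inl (a, 0)) (Sum.inr (f a))
  | tip (a b : A) : coneRel f (Sum.inl (a, 1)) (Sum.inl (b, 1))

/-- The mapping cone (homotopy cofibre) `C(f)` of a continuous map `f : A → X`. -/
def MappingCone {A X : Type u} [TopologicalSpace A] [TopologicalSpace X]
    (f : C(A, X)) : Type u :=
  Quot (coneRel f.toFun)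

instance mappingConeTopology {A X : Type u} [TopologicalSpace A] [TopologicalSpace X]
    (f : C(A, X)) : TopologicalSpace (MappingCone f) := by
  unfold MappingCone; infer_instance

/-- The wedge sum `X ∨ Y` of two pointed spaces. -/
def Wedge2 (X Y : Type u) [TopologicalSpace X] [TopologicalSpace Y]
    (x0 : X) (y0 : Y) : Type u :=
  Quot (fun p q : X ⊕ Y => p = Sum.inl x0 ∧ q = Sum.inr y0)

instance wedge2Topology (X Y : Type u) [TopologicalSpace X] [TopologicalSpace Y]
    (x0 : X) (y0 : Y) : TopologicalSpace (Wedge2 X Y x0 y0) := by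
  unfold Wedge2; infer_instance

/-- The wedge sum `⋁_i X_i` of a family of pointed spaces. -/
def PtdWedge {ι : Type u} (X : ι → Type u) [∀ i, TopologicalSpace (X i)]
    (pt : ∀ i, X i) : Type u :=
  Quot (fun p q : (Σ i, X i) => (∃ i, p = ⟨i, pt i⟩) ∧ (∃ j, q = ⟨j, pt j⟩))

instance ptdWedgeTopology {ι : Type u} (X : ι → Type u) [∀ i, TopologicalSpace (X i)]
    (pt : ∀ i, X i) : TopologicalSpace (PtdWedge X pt) := by
  unfold PtdWedge; infer_instance

/-- The relation generating the unreduced suspension (as the join with `S^0`, so that the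
suspension of the empty space is `S^0`): the two cone points are the two extra points. -/
inductive suspRel (X : Type u) : (X × unitInterval) ⊕ Bool → (X × unitInterval) ⊕ Bool → Prop
  | bot (x : X) : suspRel X (Sum.inl (x, 0)) (Sum.inr false)
  | top (x : X) : suspRel X (Sum.inl (x, 1)) (Sum.inr true)

/-- Unreduced suspension `Σ X` (with the join convention `Σ ∅ = S^0`). -/
def Susp (X : Type u) : Type u := Quot (suspRel X)

instance suspTopology (X : Type u) [TopologicalSpace X] : TopologicalSpace (Susp X) := by
  unfold Susp; infer_instance

/-- Iterated suspension `Σ^n X`. -/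
def IterSusp : ℕ → Type u → Type u
  | 0, X => X
  | n + 1, X => Susp (IterSusp n X)

instance iterSuspTopology : ∀ (n : ℕ) (X : Type u) [TopologicalSpace X],
    TopologicalSpace (IterSusp n X)
  | 0, _, i => i
  | n + 1, X, i => @suspTopology _ (@iterSuspTopology n X i)

/-- The quotient space `X / A` obtained by collapsing a subset `A` to a point. -/
def QuotBy (X : Type u) [TopologicalSpace X] (A : Set X) : Type u :=
  Quot (fun p q : X => p ∈ A ∧ q ∈ A)

instance quotByTopology (X : Type u) [TopologicalSpace X] (A : Set X) :
    TopologicalSpace (QuotBy X A) := by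
  unfold QuotBy; infer_instance

end Topology

section Aux
open unitInterval

lemma aux_collapse {X Q : Type} [TopologicalSpace X] [CompactSpace X] [TopologicalSpace Q]
    [T2Space Q] (q : C(X, Q)) (hs : Function.Surjective q) (z : Q)
    (hinj : ∀ x y, q x = q y → q x ≠ z → x = y)
    (H : C(I × X, X)) (h0 : ∀ x, H (0, x) = x)
    (hz : ∀ t x, q x = z → q (H (t, x)) = z) (p : X)
    (h1 : ∀ x, q x = z → H (1, x) = p) : Nonempty (ContinuousMap.HomotopyEquiv X Q) := by
  have hq : Topology.IsQuotientMap q := q.continuous.isClosedMap.isQuotientMap q.continuous hs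
  let H1 : C(X, X) := ⟨fun x => H (1, x), by fun_prop⟩
  have hf1 : Function.FactorsThrough H1 q := by
    intro x y hxy
    by_cases hx : q x = z
    · change H (1, x) = H (1, y)
      rw [h1 x hx, h1 y (hxy ▸ hx)]
    · rw [hinj x y hxy hx]
  let g : C(Q, X) := hq.lift H1 hf1
  have hg : ∀ x, g (q x) = H (1, x) := fun x =>
    congrArg (fun φ : C(X, X) => φ x) (hq.lift_comp H1 hf1)
  let F : C(X, C(I, Q)) := (⟨fun y : X × I => q (H (y.2, y.1)), by fun_prop⟩ : C(X × I, Q)).curry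
  have hF : Function.FactorsThrough F q := by
    intro x y hxy
    by_cases hx : q x = z
    · ext t
      change q (H (t, x)) = q (H (t, y))
      rw [hz t x hx, hz t y (hxy ▸ hx)]
    · rw [hinj x y hxy hx]
  let F' : C(Q, C(I, Q)) := hq.lift F hF
  have hF' : ∀ x t, F' (q x) t = q (H (t, x)) := fun x t =>
    congrArg (fun φ : C(X, C(I, Q)) => φ x t) (hq.lift_comp F hF)
  refine ⟨⟨q, g, ?_, ?_⟩⟩
  · refine ContinuousMap.Homotopic.symm ⟨⟨H, ?_, ?_⟩⟩
    · intro x; exact h0 x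
    · intro x; exact (hg x).symm
  · refine ContinuousMap.Homotopic.symm
      ⟨⟨⟨fun y : I × Q => F' y.2 y.1, ?_⟩, ?_, ?_⟩⟩
    · have := (ContinuousMap.uncurry F').continuous
      exact this.comp continuous_swap
    · intro y
      obtain ⟨x, rfl⟩ := hs y
      change F' (q x) 0 = q x
      rw [hF', h0]
    · intro y
      obtain ⟨x, rfl⟩ := hs y
      change F' (q x) 1 = q (g (q x))
      rw [hF', hg]

lemma aux_quotSum {α β Y : Type} [TopologicalSpace α] [TopologicalSpace β] [TopologicalSpace Y]
    (r : α ⊕ β → α ⊕ β → Prop) (f : C(α × I, Y)) (g : C(β × I, Y))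
    (hr : ∀ x y, r x y → (Sum.elim f.curry g.curry x : C(I, Y)) = Sum.elim f.curry g.curry y) :
    ∃ F : C(I × Quot r, Y), (∀ a t, F (t, Quot.mk r (Sum.inl a)) = f (a, t)) ∧
      ∀ b t, F (t, Quot.mk r (Sum.inr b)) = g (b, t) := by
  let φ : C(Quot r, C(I, Y)) := ⟨Quot.lift (Sum.elim f.curry g.curry) hr,
    continuous_quot_lift _ (Continuous.sumElim f.curry.continuous g.curry.continuous)⟩
  refine ⟨⟨fun y : I × Quot r => φ y.2 y.1,
    (ContinuousMap.uncurry φ).continuous.comp continuous_swap⟩, ?_, ?_⟩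
  · intro a t; rfl
  · intro a t; rfl

/-- contraction of the big disc in the sphere -/
lemma aux_sphere (k : ℕ) (hk : 0 < k) :
    ∃ (p : Metric.sphere (0 : EuclideanSpace ℝ (Fin k)) 1)
      (h : C(Metric.sphere (0 : EuclideanSpace ℝ (Fin k)) 1 × I,
        Metric.sphere (0 : EuclideanSpace ℝ (Fin k)) 1)),
      (∃ i, p.1 i ≤ 0) ∧ (∀ y, h (y, 0) = y) ∧ (∀ t, h (p, t) = p) ∧
      (∀ y t, (∃ i, y.1 i ≤ 0) → ∃ i, (h (y, t)).1 i ≤ 0) ∧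
      (∀ y, (∃ i, y.1 i ≤ 0) → h (y, 1) = p) := by
  have hk' : (0 : ℝ) < k := by exact_mod_cast hk
  have hsq : (0 : ℝ) < √k := Real.sqrt_pos.2 hk'
  let e : EuclideanSpace ℝ (Fin k) := WithLp.toLp 2 fun _ => 1 / √k
  have hei : ∀ i, e i = 1 / √k := fun i => rfl
  have he : ‖e‖ = 1 := by
    rw [EuclideanSpace.norm_eq]
    simp only [hei]
    simp [Real.sq_sqrt hk'.le]
    field_simp
  let w : EuclideanSpace ℝ (Fin k) → ℝ := fun y => max 0 (1 - √k ^ k * ∏ i, max 0 (y i))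
  have hwc : Continuous w := by fun_prop
  have hw0 : ∀ y, 0 ≤ w y := fun y => le_max_left _ _
  have hw1 : ∀ y, w y ≤ 1 := by
    intro y
    apply max_le zero_le_one
    have : 0 ≤ √k ^ k * ∏ i, max 0 (y i) :=
      mul_nonneg (pow_nonneg hsq.le _) (Finset.prod_nonneg fun i _ => le_max_left _ _)
    linarith
  have hwD : ∀ y : EuclideanSpace ℝ (Fin k), (∃ i, y i ≤ 0) → w y = 1 := by
    rintro y ⟨i, hi⟩
    have : ∏ i, max 0 (y i) = 0 := Finset.prod_eq_zero (Finset.mem_univ i) (max_eq_left hi)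
    simp [w, this]
  have hwe : w e = 0 := by
    have : ∏ i, max 0 (e i) = (1 / √k) ^ k := by
      simp only [hei]
      have h1 : max (0 : ℝ) (1 / √k) = 1 / √k := max_eq_right (by positivity)
      rw [Finset.prod_const, Finset.card_univ, Fintype.card_fin]
      exact congrArg (· ^ k) h1
    simp only [w, this]
    rw [← mul_pow, mul_one_div_cancel hsq.ne']
    simp
  let v : EuclideanSpace ℝ (Fin k) × ℝ → EuclideanSpace ℝ (Fin k) := fun x => (1 - x.2 * w x.1) • x.1 - (x.2 * w x.1) • e
  have hvc : Continuous v := by fun_prop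
  have hv0 : ∀ (y : EuclideanSpace ℝ (Fin k)) (t : ℝ), ‖y‖ = 1 → 0 ≤ t → v (y, t) ≠ 0 := by
    intro y t hy ht h
    have h1 : (1 - t * w y) • y = (t * w y) • e := sub_eq_zero.1 h
    have h2 := congrArg norm h1
    have h3 : 0 ≤ t * w y := mul_nonneg ht (hw0 y)
    rw [norm_smul, norm_smul, hy, he, mul_one, mul_one, Real.norm_eq_abs, Real.norm_eq_abs,
      abs_of_nonneg h3] at h2
    have h4 : 1 - t * w y = t * w y := by
      rcases abs_cases (1 - t * w y) with h | h <;> linarith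
    have h5 : t * w y ≠ 0 := by intro h; rw [h] at h4; norm_num at h4
    rw [h4] at h1
    have h6 : y = e := smul_right_injective (EuclideanSpace ℝ (Fin k)) h5 h1
    rw [h6, hwe] at h5
    simp at h5
  let nv : EuclideanSpace ℝ (Fin k) × ℝ → EuclideanSpace ℝ (Fin k) := fun x => ‖v x‖⁻¹ • v x
  have hpm : (-e) ∈ Metric.sphere (0 : EuclideanSpace ℝ (Fin k)) 1 := by simp [he]
  let h : C(Metric.sphere (0 : EuclideanSpace ℝ (Fin k)) 1 × I, Metric.sphere (0 : EuclideanSpace ℝ (Fin k)) 1) :=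
    ⟨fun x => ⟨nv (x.1.1, x.2.1), by
      have := hv0 x.1.1 x.2.1 (by simp) x.2.2.1
      simp [nv, norm_smul, this]⟩, by
      refine Continuous.subtype_mk ?_ _
      have hc : Continuous fun x : Metric.sphere (0 : EuclideanSpace ℝ (Fin k)) 1 × I => v (x.1.1, x.2.1) := by fun_prop
      refine Continuous.smul (Continuous.inv₀ hc.norm ?_) hc
      intro x
      have := hv0 x.1.1 x.2.1 (by simp) x.2.2.1
      exact norm_ne_zero_iff.2 this⟩
  have hh : ∀ y t, (h (y, t)).1 = ‖v (y.1, t.1)‖⁻¹ • v (y.1, t.1) := fun _ _ => rfl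
  have hneg : ∀ i, (-e) i ≤ 0 := by
    intro i
    simp only [PiLp.neg_apply, hei]
    have : 0 ≤ 1 / √k := by positivity
    linarith
  refine ⟨⟨-e, hpm⟩, h, ⟨⟨0, hk⟩, hneg _⟩, ?_, ?_, ?_, ?_⟩
  · intro y
    apply Subtype.ext
    have hy : ‖y.1‖ = 1 := by simp
    simp [hh, v, hy]
  · intro t
    apply Subtype.ext
    have : v (-e, t.1) = -e := by
      simp only [v]
      module
    rw [hh, this]
    simp [he]
  · rintro y t ⟨i, hi⟩
    refine ⟨i, ?_⟩
    rw [hh]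
    have hw := hwD y.1 ⟨i, hi⟩
    simp only [v, hw, PiLp.smul_apply, PiLp.sub_apply, smul_eq_mul, hei, mul_one]
    apply mul_nonpos_of_nonneg_of_nonpos (by positivity)
    have h1 : 0 ≤ t.1 := t.2.1
    have h2 : t.1 ≤ 1 := t.2.2
    have h3 : 0 ≤ t.1 * (1 / √k) := by positivity
    have h4 := mul_nonpos_of_nonneg_of_nonpos (sub_nonneg.2 h2) hi
    linarith
  · rintro y hy
    apply Subtype.ext
    have hw := hwD y.1 hy
    rw [hh]
    simp [v, hw, he]
end Aux

section Aux2
open unitInterval SComplex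

lemma aux_compact {V : Type} [Fintype V] (K : SComplex V) : CompactSpace (realization K) := by
  have hcl : IsClosed {f : V → ℝ | (∀ v, 0 ≤ f v) ∧ (∑ v, f v) = 1 ∧
      Finset.univ.filter (fun v => f v ≠ 0) ∈ K.faces} := by
    have : {f : V → ℝ | (∀ v, 0 ≤ f v) ∧ (∑ v, f v) = 1 ∧
      Finset.univ.filter (fun v => f v ≠ 0) ∈ K.faces} =
      (⋂ v, {f : V → ℝ | 0 ≤ f v}) ∩ ({f : V → ℝ | (∑ v, f v) = 1} ∩
        ⋃ s ∈ K.faces, ⋂ v, ⋂ (_ : v ∉ s), {f : V → ℝ | f v = 0}) := by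
      ext f
      simp only [Set.mem_ofPred_eq, Set.mem_inter_iff, Set.mem_iInter, Set.mem_iUnion, exists_prop]
      refine and_congr Iff.rfl (and_congr Iff.rfl ⟨fun h => ⟨_, h, ?_⟩, ?_⟩)
      · intro v hv
        simpa using hv
      · rintro ⟨s, hs, h⟩
        refine K.down_closed hs ?_
        intro v hv
        by_contra hvs
        exact (Finset.mem_filter.1 hv).2 (h v hvs)
    rw [this]
    refine IsClosed.inter (isClosed_iInter fun v => isClosed_le continuous_const (continuous_apply v))
      (IsClosed.inter (isClosed_eq (by fun_prop) continuous_const) ?_)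
    refine Set.Finite.isClosed_biUnion (Set.toFinite _) fun s _ => ?_
    exact isClosed_iInter fun v => isClosed_iInter fun _ =>
      isClosed_eq (continuous_apply v) continuous_const
  have hc : IsCompact {f : V → ℝ | (∀ v, 0 ≤ f v) ∧ (∑ v, f v) = 1 ∧
      Finset.univ.filter (fun v => f v ≠ 0) ∈ K.faces} := by
    refine IsCompact.of_isClosed_subset (isCompact_Icc (a := (0 : V → ℝ)) (b := 1)) hcl ?_
    rintro f ⟨h0, h1, -⟩
    refine ⟨fun v => h0 v, fun v => ?_⟩
    change f v ≤ 1
    rw [← h1]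
    exact Finset.single_le_sum (fun w _ => h0 w) (Finset.mem_univ v)
  exact isCompact_iff_compactSpace.1 hc

/-- mass on `U` -/
def auxMass {V : Type} [Fintype V] (U : Set V) (f : V → ℝ) : ℝ := ∑ v, if v ∈ U then f v else 0

def auxPsi (s t : ℝ) : ℝ := max 0 (1 - 4 * s * t)

def auxVec {V : Type} [Fintype V] (U : Set V) (f : V → ℝ) (t : ℝ) (v : V) : ℝ :=
  if v ∈ U then f v else auxPsi (auxMass U f) t * f v

def auxRho (t : I) : I := ⟨max 0 (2 * t.1 - 1), le_max_left _ _, max_le zero_le_one (by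
  have := t.2.2; linarith)⟩

lemma auxRho_zero : auxRho 0 = 0 := by
  apply Subtype.ext; simp [auxRho]

lemma auxRho_one : auxRho 1 = 1 := by
  apply Subtype.ext; norm_num [auxRho]

lemma auxRho_cont : Continuous auxRho := by
  unfold auxRho; exact Continuous.subtype_mk (by fun_prop) _

lemma auxMass_cont {V : Type} [Fintype V] (U : Set V) : Continuous (auxMass U) := by
  unfold auxMass
  refine continuous_finsetSum _ fun v _ => ?_
  split_ifs <;> fun_prop

lemma auxMass_nonneg {V : Type} [Fintype V] (U : Set V) (f : V → ℝ) (h : ∀ v, 0 ≤ f v) :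
    0 ≤ auxMass U f := by
  refine Finset.sum_nonneg fun v _ => ?_
  split_ifs
  · exact h v
  · exact le_rfl

lemma auxMass_le {V : Type} [Fintype V] (U : Set V) (f : V → ℝ) (h : ∀ v, 0 ≤ f v) :
    auxMass U f ≤ ∑ v, f v := by
  refine Finset.sum_le_sum fun v _ => ?_
  split_ifs
  · exact le_rfl
  · exact h v

lemma auxMass_eq {V : Type} [Fintype V] (U : Set V) (f : V → ℝ) (h : ∀ v, 0 ≤ f v)
    (h1 : ∑ v, f v = 1) : auxMass U f = 1 ↔ ∀ v, f v ≠ 0 → v ∈ U := by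
  rw [← h1]
  unfold auxMass
  rw [Finset.sum_eq_sum_iff_of_le]
  · constructor
    · intro H v hv
      by_contra hU
      have := H v (Finset.mem_univ v)
      rw [if_neg hU] at this
      exact hv this.symm
    · intro H v _
      split_ifs with hU
      · rfl
      · by_contra h2
        exact hU (H v (Ne.symm h2))
  · intro v _
    split_ifs
    · exact le_rfl
    · exact h v

lemma auxVec_nonneg {V : Type} [Fintype V] (U : Set V) (f : V → ℝ) (t : ℝ) (h : ∀ v, 0 ≤ f v)
    (v : V) : 0 ≤ auxVec U f t v := by
  unfold auxVec
  split_ifs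
  · exact h v
  · exact mul_nonneg (le_max_left _ _) (h v)

lemma auxVec_pos {V : Type} [Fintype V] (U : Set V) (f : V → ℝ) (t : ℝ) (h : ∀ v, 0 ≤ f v)
    (h1 : ∑ v, f v = 1) : 0 < ∑ v, auxVec U f t v := by
  have hn : ∀ v ∈ Finset.univ, 0 ≤ auxVec U f t v := fun v _ => auxVec_nonneg U f t h v
  refine lt_of_le_of_ne (Finset.sum_nonneg hn) fun h0 => ?_
  have h2 := (Finset.sum_eq_zero_iff_of_nonneg hn).1 h0.symm
  have h3 : auxMass U f = 0 := by
    refine Finset.sum_eq_zero fun v hv => ?_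
    have := h2 v hv
    unfold auxVec at this
    split_ifs at this ⊢ with hU
    · exact this
    · rfl
  have h4 : ∀ v, f v = 0 := by
    intro v
    have := h2 v (Finset.mem_univ v)
    unfold auxVec at this
    rw [h3] at this
    simpa [auxPsi] using this
  simp [h4] at h1

lemma auxVec_ne {V : Type} [Fintype V] (U : Set V) (f : V → ℝ) (t : ℝ) (v : V)
    (h : auxVec U f t v ≠ 0) : f v ≠ 0 := by
  intro h0
  apply h
  unfold auxVec
  simp [h0]

lemma auxVec_cont {V : Type} [Fintype V] (U : Set V) (v : V) :
    Continuous fun x : (V → ℝ) × ℝ => auxVec U x.1 x.2 v := by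
  unfold auxVec auxPsi
  have := auxMass_cont U
  split_ifs <;> fun_prop

def auxP {V : Type} [Fintype V] (K : SComplex V) (U : Set V) (x : realization K × I) :
    realization K :=
  ⟨fun v => auxVec U x.1.1 x.2.1 v / ∑ v, auxVec U x.1.1 x.2.1 v, by
    have hp := auxVec_pos U x.1.1 x.2.1 x.1.2.1 x.1.2.2.1
    refine ⟨fun v => div_nonneg (auxVec_nonneg U _ _ x.1.2.1 v) hp.le, ?_, ?_⟩
    · rw [← Finset.sum_div, div_self hp.ne']
    · refine K.down_closed x.1.2.2.2 ?_
      intro v hv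
      simp only [Finset.mem_filter, Finset.mem_univ, true_and] at hv ⊢
      refine auxVec_ne U _ x.2.1 v (fun h => hv ?_)
      rw [h, zero_div]⟩

lemma auxP_cont {V : Type} [Fintype V] (K : SComplex V) (U : Set V) : Continuous (auxP K U) := by
  refine Continuous.subtype_mk ?_ _
  have hx : Continuous fun x : realization K × I => ((x.1.1, x.2.1) : (V → ℝ) × ℝ) :=
    (continuous_subtype_val.comp continuous_fst).prodMk
      (continuous_subtype_val.comp continuous_snd)
  refine continuous_pi fun v => ?_
  refine Continuous.div ((auxVec_cont U v).comp hx)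
    (continuous_finsetSum _ fun v _ => (auxVec_cont U v).comp hx) ?_
  intro x
  exact (auxVec_pos U x.1.1 x.2.1 x.1.2.1 x.1.2.2.1).ne'

lemma auxP_zero {V : Type} [Fintype V] (K : SComplex V) (U : Set V) (x : realization K) :
    auxP K U (x, 0) = x := by
  have h : ∀ v, auxVec U x.1 0 v = x.1 v := by
    intro v; unfold auxVec auxPsi; split_ifs <;> simp
  apply Subtype.ext
  funext v
  change auxVec U x.1 0 v / ∑ v, auxVec U x.1 0 v = x.1 v
  simp only [h]
  rw [x.2.2.1, div_one]

lemma auxP_sub {V : Type} [Fintype V] (K : SComplex V) (U : Set V) (x : realization K) (t : I)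
    (hx : ∀ v, x.1 v ≠ 0 → v ∈ U) :
    auxP K U (x, t) = x := by
  have h : ∀ v, auxVec U x.1 t.1 v = x.1 v := by
    intro v; unfold auxVec; split_ifs with hU
    · rfl
    · by_cases h0 : x.1 v = 0
      · simp [h0]
      · exact absurd (hx v h0) hU
  apply Subtype.ext
  funext v
  change auxVec U x.1 t.1 v / ∑ v, auxVec U x.1 t.1 v = x.1 v
  simp only [h]
  rw [x.2.2.1, div_one]

lemma auxP_mem {V : Type} [Fintype V] (K : SComplex V) (U : Set V) (x : realization K) (t : I)
    (ht : 1 / 2 ≤ t.1) (hs : 1 / 2 ≤ auxMass U x.1) (v : V)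
    (hv : (auxP K U (x, t)).1 v ≠ 0) : v ∈ U := by
  by_contra hU
  apply hv
  change auxVec U x.1 t.1 v / _ = 0
  have : auxPsi (auxMass U x.1) t.1 = 0 := by
    unfold auxPsi
    apply max_eq_left
    nlinarith
  unfold auxVec
  rw [if_neg hU, this]
  simp

lemma aux_hep {V : Type} [Fintype V] (K : SComplex V) (U : Set V) {Y : Type} [TopologicalSpace Y]
    (g : C(realization K, Y)) (h : C(realization (inducedSub K U) × I, Y))
    (hg : ∀ a, h (a, 0) = g (inclMap (K := inducedSub K U) (L := K) (fun _ hs => hs.1) a)) :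
    ∃ E : C(realization K × I, Y), (∀ x, E (x, 0) = g x) ∧
      ∀ a t, E (inclMap (K := inducedSub K U) (L := K) (fun _ hs => hs.1) a, t)
        = h (a, auxRho t) := by
  let C2 : Set (realization K × I) := {x | 1 / 2 ≤ x.2.1 ∧ 1 / 2 ≤ auxMass U x.1.1}
  let C1 : Set (realization K × I) := {x | x.2.1 ≤ 1 / 2 ∨ auxMass U x.1.1 ≤ 1 / 2}
  have hmc : Continuous fun x : realization K × I => auxMass U x.1.1 :=
    (auxMass_cont U).comp (continuous_subtype_val.comp continuous_fst)
  have htc : Continuous fun x : realization K × I => x.2.1 :=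
    continuous_subtype_val.comp continuous_snd
  have hC2 : IsClosed C2 :=
    (isClosed_le continuous_const htc).inter (isClosed_le continuous_const hmc)
  have hC1 : IsClosed C1 :=
    (isClosed_le htc continuous_const).union (isClosed_le hmc continuous_const)
  let lft : C2 → realization (inducedSub K U) := fun x =>
    ⟨(auxP K U x.1).1, (auxP K U x.1).2.1, (auxP K U x.1).2.2.1, (auxP K U x.1).2.2.2, by
      intro v hv
      exact auxP_mem K U x.1.1 x.1.2 x.2.1 x.2.2 v (Finset.mem_filter.1 hv).2⟩
  have hlft : Continuous lft := Continuous.subtype_mk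
    (continuous_subtype_val.comp ((auxP_cont K U).comp continuous_subtype_val)) _
  let θ : realization K × I → I := fun x =>
    ⟨max 0 (2 * x.2.1 - 1) * max 0 (2 * auxMass U x.1.1 - 1),
      mul_nonneg (le_max_left _ _) (le_max_left _ _), by
        have h1 : max 0 (2 * x.2.1 - 1) ≤ 1 := (auxRho x.2).2.2
        have h2 : auxMass U x.1.1 ≤ 1 := (auxMass_le U x.1.1 x.1.2.1).trans x.1.2.2.1.le
        have h3 : max 0 (2 * auxMass U x.1.1 - 1) ≤ 1 := max_le zero_le_one (by linarith)
        exact mul_le_one₀ h1 (le_max_left _ _) h3⟩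
  have hθ : Continuous θ := Continuous.subtype_mk
    ((continuous_const.max (by fun_prop)).mul (continuous_const.max (by fun_prop))) _
  have hθ0 : ∀ x ∈ C1, θ x = 0 := by
    rintro x (hx | hx)
    · apply Subtype.ext
      change max 0 (2 * x.2.1 - 1) * max 0 (2 * auxMass U x.1.1 - 1) = 0
      rw [max_eq_left (by linarith), zero_mul]
    · apply Subtype.ext
      change max 0 (2 * x.2.1 - 1) * max 0 (2 * auxMass U x.1.1 - 1) = 0
      rw [max_eq_left (b := 2 * auxMass U x.1.1 - 1) (by linarith), mul_zero]
  let E : realization K × I → Y := fun x =>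
    if hx : x ∈ C2 then h (lft ⟨x, hx⟩, θ x) else g (auxP K U x)
  have hE1 : ∀ x ∈ C1, E x = g (auxP K U x) := by
    intro x hx
    by_cases hx2 : x ∈ C2
    · simp only [E, dif_pos hx2]
      rw [hθ0 x hx, hg]
      rfl
    · simp only [E, dif_neg hx2]
  have hE2 : ∀ x (hx : x ∈ C2), E x = h (lft ⟨x, hx⟩, θ x) := by
    intro x hx
    simp only [E, dif_pos hx]
  have hEc : Continuous E := by
    have c1 : ContinuousOn E C1 :=
      ((g.continuous.comp (auxP_cont K U)).continuousOn).congr hE1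
    have c2 : ContinuousOn E C2 := by
      rw [continuousOn_iff_continuous_domRestrict]
      have : C2.domRestrict E = fun x : C2 => h (lft x, θ x.1) := by
        funext x; exact hE2 x.1 x.2
      rw [this]
      exact h.continuous.comp (hlft.prodMk (hθ.comp continuous_subtype_val))
    have := c1.union_of_isClosed c2 hC1 hC2
    have hu : C1 ∪ C2 = Set.univ := by
      ext x
      simp only [C1, C2, Set.mem_union, Set.mem_ofPred_eq, Set.mem_univ, iff_true]
      rcases le_total x.2.1 (1 / 2) with h1 | h1
      · exact Or.inl (Or.inl h1)
      rcases le_total (auxMass U x.1.1) (1 / 2) with h2 | h2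
      · exact Or.inl (Or.inr h2)
      · exact Or.inr ⟨h1, h2⟩
    rw [hu] at this
    exact continuousOn_univ.1 this
  refine ⟨⟨E, hEc⟩, ?_, ?_⟩
  · intro x
    change E (x, 0) = g x
    rw [hE1 _ (Or.inl (by simp)), auxP_zero]
  · intro a t
    change E (inclMap (K := inducedSub K U) (L := K) (fun _ hs => hs.1) a, t) = _
    have ha : ∀ v, a.1 v ≠ 0 → v ∈ U := fun v hv =>
      a.2.2.2.2 v (Finset.mem_filter.2 ⟨Finset.mem_univ _, hv⟩)
    have hP := auxP_sub K U (inclMap (K := inducedSub K U) (L := K) (fun _ hs => hs.1) a) t ha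
    have hm : auxMass U a.1 = 1 := (auxMass_eq U a.1 a.2.1 a.2.2.1).2 ha
    rcases le_total t.1 (1 / 2) with h1 | h1
    · rw [hE1 _ (Or.inl h1), hP]
      have : auxRho t = 0 := Subtype.ext (max_eq_left (by linarith))
      rw [this, hg]
    · have hx : (inclMap (K := inducedSub K U) (L := K) (fun _ hs => hs.1) a, t) ∈ C2 :=
        ⟨h1, by change 1 / 2 ≤ auxMass U a.1; rw [hm]; norm_num⟩
      rw [hE2 _ hx]
      congr 1
      refine Prod.ext ?_ ?_
      · apply Subtype.ext
        exact congrArg (fun y : realization K => y.1) hP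
      · apply Subtype.ext
        change max 0 (2 * t.1 - 1) * max 0 (2 * auxMass U a.1 - 1) = max 0 (2 * t.1 - 1)
        rw [hm]; norm_num
end Aux2

section Aux3
open unitInterval SComplex

structure AuxCfg {V : Type} (G : SimpleGraph V) (k : ℕ) (a b : Fin k → V) (U : Set V) : Prop where
  ainj : ∀ i j, a i = a j → i = j
  binj : ∀ i j, b i = b j → i = j
  ab : ∀ i j, a i ≠ b j
  mem : ∀ v, v ∈ U ↔ (∃ i, v = a i) ∨ ∃ i, v = b i
  adj : ∀ i, G.Adj (a i) (b i)
  na : ∀ i j, ¬ G.Adj (a i) (a j)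
  nb : ∀ i j, ¬ G.Adj (b i) (b j)
  nab : ∀ i j, i ≠ j → ¬ G.Adj (a i) (b j)
  dom : ∀ v, (∃ i, v = a i) ∨ ∃ i, G.Adj (a i) v

lemma aux_indep {V : Type} [Fintype V] {G : SimpleGraph V} (x : realization (indepComplex G))
    {v w : V} (hv : x.1 v ≠ 0) (hw : x.1 w ≠ 0) : ¬ G.Adj v w :=
  x.2.2.2 v (Finset.mem_filter.2 ⟨Finset.mem_univ _, hv⟩) w
    (Finset.mem_filter.2 ⟨Finset.mem_univ _, hw⟩)

lemma aux_homeo {V : Type} [Fintype V] {G : SimpleGraph V} {k : ℕ} {a b : Fin k → V} {U : Set V}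
    (c : AuxCfg G k a b U) :
    ∃ Φ : realization (inducedSub (indepComplex G) U) ≃ₜ
      Metric.sphere (0 : EuclideanSpace ℝ (Fin k)) 1,
      ∀ f, (∃ i, (Φ f).1 i ≤ 0) ↔ ∃ i, f.1 (a i) = 0 := by
  let A := realization (inducedSub (indepComplex G) U)
  let y : A → EuclideanSpace ℝ (Fin k) := fun f => WithLp.toLp 2 fun i => f.1 (a i) - f.1 (b i)
  have hyi : ∀ f i, y f i = f.1 (a i) - f.1 (b i) := fun f i => rfl
  have hyc : Continuous y := by
    refine (PiLp.continuous_toLp 2 _).comp (continuous_pi fun i => ?_)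
    have h1 : Continuous fun f : A => f.1 := continuous_subtype_val
    exact ((continuous_apply (a i)).comp h1).sub ((continuous_apply (b i)).comp h1)
  have hU : ∀ (f : A) v, f.1 v ≠ 0 → v ∈ U := fun f v hv =>
      f.2.2.2.2 v (Finset.mem_filter.2 ⟨Finset.mem_univ _, hv⟩)
  have hab : ∀ (f : A) i, f.1 (a i) = 0 ∨ f.1 (b i) = 0 := by
    intro f i
    by_contra h
    push Not at h
    exact f.2.2.2.1 _ (Finset.mem_filter.2 ⟨Finset.mem_univ _, h.1⟩) _
      (Finset.mem_filter.2 ⟨Finset.mem_univ _, h.2⟩) (c.adj i)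
  have hfa : ∀ (f : A) i, f.1 (a i) = max 0 (y f i) := by
    intro f i
    rw [hyi]
    have h1 := f.2.1 (a i)
    have h2 := f.2.1 (b i)
    rcases hab f i with h | h
    · rw [h, max_eq_left]; linarith
    · rw [h, sub_zero, max_eq_right h1]
  have hfb : ∀ (f : A) i, f.1 (b i) = max 0 (-(y f i)) := by
    intro f i
    rw [hyi]
    have h1 := f.2.1 (a i)
    have h2 := f.2.1 (b i)
    rcases hab f i with h | h
    · rw [h, max_eq_right] <;> linarith
    · rw [h, max_eq_left]; linarith
  have hy0 : ∀ f, y f ≠ 0 := by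
    intro f h
    have : ∀ v, f.1 v = 0 := by
      intro v
      by_contra hv
      rcases (c.mem v).1 (hU f v hv) with ⟨i, rfl⟩ | ⟨i, rfl⟩
      · rw [hfa, h] at hv; simp at hv
      · rw [hfb, h] at hv; simp at hv
    have h1 := f.2.2.1
    simp [this] at h1
  let φ : A → Metric.sphere (0 : EuclideanSpace ℝ (Fin k)) 1 := fun f =>
    ⟨‖y f‖⁻¹ • y f, by
      have := hy0 f
      simp [norm_smul, this]⟩
  have hφ : ∀ f, (φ f).1 = ‖y f‖⁻¹ • y f := fun f => rfl
  have hφc : Continuous φ := Continuous.subtype_mk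
    ((hyc.norm.inv₀ fun f => norm_ne_zero_iff.2 (hy0 f)).smul hyc) _
  have hinj : Function.Injective φ := by
    intro f g hfg
    have h1 : ‖y f‖⁻¹ • y f = ‖y g‖⁻¹ • y g := congrArg Subtype.val hfg
    have hf := norm_pos_iff.2 (hy0 f)
    have hg := norm_pos_iff.2 (hy0 g)
    obtain ⟨r, hr, h2⟩ : ∃ r : ℝ, 0 < r ∧ y f = r • y g := by
      refine ⟨‖y f‖ * ‖y g‖⁻¹, by positivity, ?_⟩
      rw [mul_smul, ← h1, smul_smul, mul_inv_cancel₀ hf.ne', one_smul]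
    have h3 : ∀ v, f.1 v = r * g.1 v := by
      have hm : ∀ z : ℝ, max 0 (r * z) = r * max 0 z := by
        intro z
        rw [mul_max_of_nonneg _ _ hr.le, mul_zero]
      intro v
      by_cases hv : v ∈ U
      · rcases (c.mem v).1 hv with ⟨i, rfl⟩ | ⟨i, rfl⟩
        · rw [hfa, hfa, h2, PiLp.smul_apply, smul_eq_mul, hm]
        · rw [hfb, hfb, h2, PiLp.smul_apply, smul_eq_mul, ← mul_neg, hm]
      · have h4 : f.1 v = 0 := by by_contra h; exact hv (hU f v h)
        have h5 : g.1 v = 0 := by by_contra h; exact hv (hU g v h)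
        rw [h4, h5, mul_zero]
    have h4 : r = 1 := by
      have h5 := f.2.2.1
      simp only [h3] at h5
      rw [← Finset.mul_sum, g.2.2.1, mul_one] at h5
      exact h5
    apply Subtype.ext
    funext v
    rw [h3, h4, one_mul]
  have hsurj : Function.Surjective φ := by
    intro z
    let F : V → ℝ := fun v => ∑ i, ((if v = a i then max 0 (z.1 i) else 0) +
      if v = b i then max 0 (-z.1 i) else 0)
    have hF0 : ∀ v, 0 ≤ F v := by
      intro v
      refine Finset.sum_nonneg fun i _ => add_nonneg ?_ ?_
      · split_ifs
        · exact le_max_left _ _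
        · exact le_rfl
      · split_ifs
        · exact le_max_left _ _
        · exact le_rfl
    have hFa : ∀ i, F (a i) = max 0 (z.1 i) := by
      intro i
      simp only [F]
      rw [Finset.sum_eq_single i]
      · simp [c.ab i i]
      · intro j _ hj
        rw [if_neg (fun h => hj (c.ainj _ _ h).symm), if_neg (c.ab i j), add_zero]
      · simp
    have hFb : ∀ i, F (b i) = max 0 (-z.1 i) := by
      intro i
      simp only [F]
      rw [Finset.sum_eq_single i]
      · simp [(c.ab i i).symm]
      · intro j _ hj
        rw [if_neg (c.ab j i).symm, if_neg (fun h => hj (c.binj _ _ h).symm), add_zero]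
      · simp
    have hFs : ∀ v, F v ≠ 0 → (∃ i, v = a i ∧ 0 < z.1 i) ∨ ∃ i, v = b i ∧ z.1 i < 0 := by
      intro v hv
      obtain ⟨i, -, hi⟩ := Finset.exists_ne_zero_of_sum_ne_zero hv
      by_cases h1 : v = a i
      · subst h1
        rw [hFa] at hv
        refine Or.inl ⟨i, rfl, ?_⟩
        by_contra h
        exact hv (max_eq_left (not_lt.1 h))
      · by_cases h2 : v = b i
        · subst h2
          rw [hFb] at hv
          refine Or.inr ⟨i, rfl, ?_⟩
          by_contra h
          exact hv (max_eq_left (by linarith))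
        · simp [h1, h2] at hi
    have hz0 : z.1 ≠ 0 := by
      intro h
      have h2 : ‖z.1‖ = 1 := by simp
      rw [h] at h2
      simp at h2
    have hT : 0 < ∑ v, F v := by
      obtain ⟨i, hi⟩ : ∃ i, z.1 i ≠ 0 := by
        by_contra h
        push Not at h
        exact hz0 (by ext i; exact h i)
      rcases lt_or_gt_of_ne hi with h | h
      · refine Finset.sum_pos' (fun v _ => hF0 v) ⟨b i, Finset.mem_univ _, ?_⟩
        rw [hFb]; exact lt_max_of_lt_right (by linarith)
      · refine Finset.sum_pos' (fun v _ => hF0 v) ⟨a i, Finset.mem_univ _, ?_⟩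
        rw [hFa]; exact lt_max_of_lt_right h
    have hsupp : ∀ v, F v / ∑ v, F v ≠ 0 → F v ≠ 0 := by
      intro v hv h; rw [h, zero_div] at hv; exact hv rfl
    let f : A := ⟨fun v => F v / ∑ v, F v, fun v => div_nonneg (hF0 v) hT.le, by
      rw [← Finset.sum_div, div_self hT.ne'], by
      constructor
      · intro v hv w hw
        have hv := hFs v (hsupp v (Finset.mem_filter.1 hv).2)
        have hw := hFs w (hsupp w (Finset.mem_filter.1 hw).2)
        rcases hv with ⟨i, rfl, hi⟩ | ⟨i, rfl, hi⟩ <;> rcases hw with ⟨j, rfl, hj⟩ | ⟨j, rfl, hj⟩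
        · exact c.na i j
        · refine c.nab i j ?_
          rintro rfl; linarith
        · intro h
          refine c.nab j i ?_ h.symm
          rintro rfl; linarith
        · exact c.nb i j
      · intro v hv
        have hv := hFs v (hsupp v (Finset.mem_filter.1 hv).2)
        rw [c.mem]
        rcases hv with ⟨i, rfl, hi⟩ | ⟨i, rfl, hi⟩
        · exact Or.inl ⟨i, rfl⟩
        · exact Or.inr ⟨i, rfl⟩⟩
    have hf : ∀ v, f.1 v = F v / ∑ v, F v := fun v => rfl
    have hyz : y f = (∑ v, F v)⁻¹ • z.1 := by
      ext i
      rw [hyi, hf, hf, hFa, hFb, PiLp.smul_apply, smul_eq_mul, ← sub_div, div_eq_inv_mul]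
      congr 1
      rcases le_total (z.1 i) 0 with h | h
      · rw [max_eq_left h, max_eq_right (by linarith)]; ring
      · rw [max_eq_right h, max_eq_left (by linarith)]; ring
    refine ⟨f, Subtype.ext ?_⟩
    have h2 : ‖z.1‖ = 1 := by simp
    rw [hφ, hyz, norm_smul, h2, mul_one, norm_inv, Real.norm_of_nonneg hT.le, inv_inv, smul_smul,
      mul_inv_cancel₀ hT.ne', one_smul]
  have : CompactSpace A := aux_compact _
  refine ⟨hφc.homeoOfEquivCompactToT2 (f := Equiv.ofBijective φ ⟨hinj, hsurj⟩), fun f => ?_⟩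
  change (∃ i, (φ f).1 i ≤ 0) ↔ _
  refine exists_congr fun i => ?_
  rw [hφ, hfa, PiLp.smul_apply, smul_eq_mul]
  have := inv_pos.2 (norm_pos_iff.2 (hy0 f))
  rw [max_eq_left_iff]
  constructor
  · intro h; by_contra h'; push Not at h'
    exact absurd h (not_le.2 (mul_pos this h'))
  · intro h; exact mul_nonpos_of_nonneg_of_nonpos this.le h

end Aux3

section Aux4
open unitInterval SComplex

lemma aux_prod {V : Type} [Fintype V] {G : SimpleGraph V} {k : ℕ} {a b : Fin k → V} {U : Set V}
    (c : AuxCfg G k a b U) (x : realization (indepComplex G)) (hx : auxMass U x.1 ≠ 1) :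
    ∏ i, x.1 (a i) = 0 := by
  by_contra h
  have h := Finset.prod_ne_zero_iff.1 h
  apply hx
  rw [auxMass_eq U x.1 x.2.1 x.2.2.1]
  intro v hv
  rw [c.mem]
  rcases c.dom v with ⟨i, rfl⟩ | ⟨i, hi⟩
  · exact Or.inl ⟨i, rfl⟩
  · exact absurd hi (aux_indep x (h i (Finset.mem_univ i)) hv)

lemma aux_main {V : Type} [Fintype V] [Nonempty V] {G : SimpleGraph V} {k : ℕ} {a b : Fin k → V}
    {U : Set V} (c : AuxCfg G k a b U) :
    ∃ (pm : realization (inducedSub (indepComplex G) U))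
       (pc : MappingCone (inclMap (K := inducedSub (indepComplex G) U)
          (L := indepComplex G) (fun _ hs => hs.1))),
       Nonempty (ContinuousMap.HomotopyEquiv (realization (indepComplex G))
         (Wedge2 _ _ pm pc)) := by
  have hk : 0 < k := by
    obtain ⟨v⟩ := ‹Nonempty V›
    rcases c.dom v with ⟨i, -⟩ | ⟨i, -⟩ <;> exact i.pos
  have m0 : ∀ u : I, max 0 u = u := fun u => max_eq_right (show (0:I) ≤ u from u.2.1)
  have m0' : ∀ u : I, max u 0 = u := fun u => max_eq_left (show (0:I) ≤ u from u.2.1)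
  have m1 : ∀ u : I, max 1 u = 1 := fun u => max_eq_left (show u ≤ (1:I) from u.2.2)
  have m1' : ∀ u : I, max u 1 = 1 := fun u => max_eq_right (show u ≤ (1:I) from u.2.2)
  let K := indepComplex G
  let j : C(realization (inducedSub K U), realization K) :=
    inclMap (K := inducedSub (indepComplex G) U) (L := indepComplex G) (fun _ hs => hs.1)
  have hj : ∀ y, (j y).1 = y.1 := fun y => rfl
  obtain ⟨Φ, hΦ⟩ := aux_homeo c
  obtain ⟨p0, h0, hp0, hh0, hhp, hhD, hh1⟩ := aux_sphere k hk
  have cX : CompactSpace (realization K) := aux_compact _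
  have cA : CompactSpace (realization (inducedSub K U)) := aux_compact _
  let π : (V → ℝ) → ℝ := fun f => ∏ i, f (a i)
  have hπc : Continuous π := by fun_prop
  have hπ : ∀ f, π f = 0 ↔ ∃ i, f (a i) = 0 := by
    intro f; simp [π, Finset.prod_eq_zero_iff]
  let hA : C(realization (inducedSub K U) × I, realization (inducedSub K U)) :=
    ⟨fun x => Φ.symm (h0 (Φ x.1, x.2)), by fun_prop⟩
  have hAe : ∀ y t, hA (y, t) = Φ.symm (h0 (Φ y, t)) := fun _ _ => rfl
  let p : realization (inducedSub K U) := Φ.symm p0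
  have hA0 : ∀ y, hA (y, 0) = y := by intro y; rw [hAe, hh0]; simp
  have hAp : ∀ t, hA (p, t) = p := by
    intro t; rw [hAe]; simp only [p, Homeomorph.apply_symm_apply]; rw [hhp]
  have hAD : ∀ y t, π y.1 = 0 → π (hA (y, t)).1 = 0 := by
    intro y t hy
    rw [hπ, ← hΦ] at hy ⊢
    rw [hAe, Homeomorph.apply_symm_apply]
    exact hhD _ _ hy
  have hA1 : ∀ y, π y.1 = 0 → hA (y, 1) = p := by
    intro y hy
    rw [hπ, ← hΦ] at hy
    rw [hAe, hh1 _ hy]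
  have hπp : π p.1 = 0 := by
    rw [hπ, ← hΦ]
    simpa [p] using hp0
  have hmA : ∀ y : realization (inducedSub K U), auxMass U y.1 = 1 := fun y =>
    (auxMass_eq U y.1 y.2.1 y.2.2.1).2 fun v hv =>
      y.2.2.2.2 v (Finset.mem_filter.2 ⟨Finset.mem_univ _, hv⟩)
  have hmX : ∀ x : realization K, auxMass U x.1 = 1 → ∃ y, j y = x := by
    intro x hx
    have h1 := (auxMass_eq U x.1 x.2.1 x.2.2.1).1 hx
    exact ⟨⟨x.1, x.2.1, x.2.2.1, x.2.2.2, fun v hv => h1 v (Finset.mem_filter.1 hv).2⟩, rfl⟩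
  have hmle : ∀ x : realization K, auxMass U x.1 ≤ 1 := fun x =>
    (auxMass_le U x.1 x.2.1).trans x.2.2.1.le
  have hπnn : ∀ x : realization K, 0 ≤ π x.1 := fun x => Finset.prod_nonneg fun i _ => x.2.1 _
  -- the collapse of X
  let S : ℝ × (V → ℝ) → (V → ℝ) × ℝ := fun x => (x.1 • x.2, x.1)
  have hSc : Continuous S := by fun_prop
  have hS0 : ∀ r f, S (r, f) = 0 ↔ r = 0 := by
    intro r f
    simp only [S, Prod.ext_iff, Prod.fst_zero, Prod.snd_zero]
    constructor
    · exact fun h => h.2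
    · rintro rfl; simp
  have hSi : ∀ r f r' f', S (r, f) = S (r', f') → r ≠ 0 → f = f' := by
    intro r f r' f' h hr
    simp only [S, Prod.mk.injEq] at h
    obtain ⟨h1, rfl⟩ := h
    exact smul_right_injective _ hr h1
  let d : (V → ℝ) → ℝ := fun f => (1 - auxMass U f) + π f
  have hmc := auxMass_cont U
  have hdc : Continuous d := by fun_prop
  let qX : realization K → (V → ℝ) × ℝ := fun x => S (d x.1, x.1)
  have hval : Continuous fun x : realization K => x.1 := continuous_subtype_val
  have hvalA : Continuous fun x : realization (inducedSub K U) => x.1 := continuous_subtype_val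
  have hqX : Continuous qX := by fun_prop
  have hdj : ∀ y, d (j y).1 = π y.1 := by
    intro y; simp only [d, hj, hmA]; ring
  have hdX : ∀ x : realization K, auxMass U x.1 ≠ 1 → d x.1 = 1 - auxMass U x.1 := by
    intro x hx
    have : π x.1 = 0 := aux_prod c x hx
    simp only [d, this, add_zero]
  have hd0 : ∀ x : realization K, d x.1 = 0 → ∃ y, j y = x ∧ π y.1 = 0 := by
    intro x hx
    have h1 := hmle x
    have h2 := hπnn x
    have h3 : auxMass U x.1 = 1 := by simp only [d] at hx; linarith
    obtain ⟨y, rfl⟩ := hmX x h3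
    exact ⟨y, rfl, by rw [← hdj]; exact hx⟩
  have hz0 : qX (j p) = 0 := by
    simp only [qX]; rw [hS0, hdj, hπp]
  let Q := Set.range qX
  let z : Q := ⟨0, j p, hz0⟩
  have e1 : Nonempty (ContinuousMap.HomotopyEquiv (realization K) Q) := by
    obtain ⟨E, hE0, hE⟩ := aux_hep K U (ContinuousMap.id _) (j.comp hA) (by
      intro y
      change j (hA (y, 0)) = j y
      rw [hA0])
    have hEj : ∀ y t, E (j y, t) = j (hA (y, auxRho t)) := fun y t => hE y t
    have hqz : ∀ x, (⟨qX x, x, rfl⟩ : Q) = z ↔ d x.1 = 0 := by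
      intro x; rw [Subtype.ext_iff]; exact hS0 _ _
    refine aux_collapse (⟨fun x => ⟨qX x, x, rfl⟩, hqX.subtype_mk _⟩ : C(realization K, Q)) ?_ z
      ?_ ⟨fun x => E (x.2, x.1), by fun_prop⟩ ?_ ?_ (j p) ?_
    · rintro ⟨_, x, rfl⟩; exact ⟨x, rfl⟩
    · intro x y hxy hx
      exact Subtype.ext (hSi _ _ _ _ (congrArg Subtype.val hxy) (fun h => hx ((hqz x).2 h)))
    · intro x; exact hE0 x
    · intro t x hx
      obtain ⟨y, rfl, hy⟩ := hd0 x ((hqz x).1 hx)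
      refine (hqz _).2 ?_
      change d (E (j y, t)).1 = 0
      rw [hEj, hdj, hAD _ _ hy]
    · intro x hx
      obtain ⟨y, rfl, hy⟩ := hd0 x ((hqz x).1 hx)
      change E (j y, 1) = j p
      rw [hEj, auxRho_one, hA1 _ hy]
  -- the wedge
  let C := MappingCone j
  let mk : ((realization (inducedSub K U)) × I) ⊕ realization K → C := Quot.mk (coneRel j.toFun)
  have hmk : Continuous mk := continuous_quot_mk
  have hbase : ∀ y, mk (Sum.inl (y, 0)) = mk (Sum.inr (j y)) := fun y =>
    Quot.sound (coneRel.base y)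
  have htip : ∀ y y', mk (Sum.inl (y, 1)) = mk (Sum.inl (y', 1)) := fun y y' =>
    Quot.sound (coneRel.tip y y')
  let tip : C := mk (Sum.inl (p, 1))
  let W := Wedge2 (realization (inducedSub K U)) C p tip
  let wk : realization (inducedSub K U) ⊕ C → W := Quot.mk _
  have hwk : Continuous wk := continuous_quot_mk
  have hglue : wk (Sum.inl p) = wk (Sum.inr tip) := Quot.sound ⟨rfl, rfl⟩
  refine ⟨p, tip, ?_⟩
  -- homotopy on the cone
  obtain ⟨KC, hKC1, hKC2, hKC0⟩ : ∃ KC : C(I × C, C),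
      (∀ y u t, KC (t, mk (Sum.inl (y, u))) = mk (Sum.inl (y, max u (auxRho t)))) ∧
      (∀ y t, KC (t, mk (Sum.inr (j y))) = mk (Sum.inl (y, auxRho t))) ∧
      (∀ x, KC (0, x) = x) := by
    obtain ⟨E, hE0, hE⟩ := aux_hep K U (Y := C) ⟨fun x => mk (Sum.inr x), by fun_prop⟩
      ⟨fun x => mk (Sum.inl x), by fun_prop⟩ (by
        intro y
        exact hbase y)
    have hEj : ∀ y t, E (j y, t) = mk (Sum.inl (y, auxRho t)) := fun y t => hE y t
    have hρ := auxRho_cont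
    obtain ⟨F, hF1, hF2⟩ := aux_quotSum (Y := C) (coneRel j.toFun)
      ⟨fun x : (realization (inducedSub K U) × I) × I => mk (Sum.inl (x.1.1, max x.1.2 (auxRho x.2))),
        by fun_prop⟩ E (by
      intro x y hxy
      cases hxy with
      | base y =>
        ext t
        change mk (Sum.inl (y, max 0 (auxRho t))) = E (j y, t)
        rw [hEj, m0]
      | tip y y' =>
        ext t
        change mk (Sum.inl (y, max 1 (auxRho t))) = mk (Sum.inl (y', max 1 (auxRho t)))
        rw [m1]
        exact htip _ _)
    refine ⟨F, fun y u t => hF1 (y, u) t, fun y t => (hF2 (j y) t).trans (hEj y t), ?_⟩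
    intro x
    induction x using Quot.ind with
    | mk x =>
      rcases x with ⟨y, u⟩ | x
      · refine (hF1 (y, u) 0).trans ?_
        change mk (Sum.inl (y, max u (auxRho 0))) = mk (Sum.inl (y, u))
        rw [auxRho_zero, m0']
      · refine (hF2 x 0).trans ?_
        exact hE0 x
  have hKCtip : ∀ t, KC (t, tip) = tip := by
    intro t
    simp only [tip]
    rw [hKC1, m1]
  have hKCone : ∀ y u, KC (1, mk (Sum.inl (y, u))) = tip := by
    intro y u
    rw [hKC1, auxRho_one, m1']
    exact htip _ _
  -- homotopy on the wedge
  obtain ⟨H, hH1, hH2⟩ : ∃ H : C(I × W, W),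
      (∀ y t, H (t, wk (Sum.inl y)) = wk (Sum.inl (hA (y, t)))) ∧
      (∀ x t, H (t, wk (Sum.inr x)) = wk (Sum.inr (KC (t, x)))) := by
   obtain ⟨H, h1, h2⟩ := aux_quotSum (Y := W)
    (fun x y : realization (inducedSub K U) ⊕ C => x = Sum.inl p ∧ y = Sum.inr tip)
    ⟨fun x : realization (inducedSub K U) × I => wk (Sum.inl (hA x)), by fun_prop⟩
    ⟨fun x : C × I => wk (Sum.inr (KC (x.2, x.1))), by fun_prop⟩ (by
      rintro x y ⟨rfl, rfl⟩
      ext t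
      change wk (Sum.inl (hA (p, t))) = wk (Sum.inr (KC (t, tip)))
      rw [hAp, hKCtip, hglue])
   exact ⟨H, h1, h2⟩
  -- the collapse of W
  let qC : C → (V → ℝ) × ℝ := Quot.lift
    (Sum.elim (fun _ => 0) fun x : realization K => S (1 - auxMass U x.1, x.1)) (by
      intro x y hxy
      cases hxy with
      | base y =>
        change 0 = S (1 - auxMass U (j y).1, (j y).1)
        rw [hj, hmA, sub_self]
        exact ((hS0 _ _).2 rfl).symm
      | tip y y' => rfl)
  have hqC : Continuous qC := continuous_quot_lift _
    (Continuous.sumElim continuous_const (by fun_prop))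
  let qW : W → (V → ℝ) × ℝ := Quot.lift
    (Sum.elim (fun y : realization (inducedSub K U) => S (π y.1, y.1)) qC) (by
      rintro x y ⟨rfl, rfl⟩
      change S (π p.1, p.1) = 0
      exact (hS0 _ _).2 hπp)
  have hqW : Continuous qW := continuous_quot_lift _
    (Continuous.sumElim (by fun_prop) hqC)
  have q1 : ∀ y, qW (wk (Sum.inl y)) = S (π y.1, y.1) := fun _ => rfl
  have q2 : ∀ y, qW (wk (Sum.inr (mk (Sum.inl y)))) = 0 := fun _ => rfl
  have q3 : ∀ x, qW (wk (Sum.inr (mk (Sum.inr x)))) = S (1 - auxMass U x.1, x.1) := fun _ => rfl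
  have hcases : ∀ P : W → Prop, (∀ y, P (wk (Sum.inl y))) →
      (∀ y u, P (wk (Sum.inr (mk (Sum.inl (y, u)))))) →
      (∀ x, auxMass U x.1 ≠ 1 → P (wk (Sum.inr (mk (Sum.inr x))))) → ∀ w, P w := by
    intro P h1 h2 h3 w
    induction w using Quot.ind with
    | mk w =>
      rcases w with y | w
      · exact h1 y
      · induction w using Quot.ind with
        | mk w =>
          rcases w with ⟨y, u⟩ | x
          · exact h2 y u
          · by_cases hx : auxMass U x.1 = 1
            · obtain ⟨y, rfl⟩ := hmX x hx
              change P (wk (Sum.inr (mk (Sum.inr (j y)))))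
              rw [← hbase]
              exact h2 y 0
            · exact h3 x hx
  have hr : ∀ w, qW w ∈ Set.range qX := by
    refine hcases _ ?_ ?_ ?_
    · intro y
      refine ⟨j y, ?_⟩
      rw [q1]
      change S (d (j y).1, (j y).1) = _
      rw [hdj, hj]
    · intro y u
      exact ⟨j p, hz0⟩
    · intro x hx
      refine ⟨x, ?_⟩
      rw [q3]
      change S (d x.1, x.1) = _
      rw [hdX x hx]
  have cC : CompactSpace C := by
    change CompactSpace (Quot (coneRel j.toFun))
    infer_instance
  have cW : CompactSpace W := by
    change CompactSpace (Quot _)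
    infer_instance
  have hwz : ∀ w, (⟨qW w, hr w⟩ : Q) = z ↔ qW w = 0 := by
    intro w; rw [Subtype.ext_iff]
  have e2 : Nonempty (ContinuousMap.HomotopyEquiv W Q) := by
    refine aux_collapse (⟨fun w => ⟨qW w, hr w⟩, hqW.subtype_mk _⟩ : C(W, Q)) ?_ z
      ?_ H ?_ ?_ (wk (Sum.inl p)) ?_
    · rintro ⟨_, x, rfl⟩
      by_cases hx : auxMass U x.1 = 1
      · obtain ⟨y, rfl⟩ := hmX x hx
        refine ⟨wk (Sum.inl y), Subtype.ext ?_⟩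
        change S (π y.1, y.1) = S (d (j y).1, (j y).1)
        rw [hdj, hj]
      · refine ⟨wk (Sum.inr (mk (Sum.inr x))), Subtype.ext ?_⟩
        change S (1 - auxMass U x.1, x.1) = S (d x.1, x.1)
        rw [hdX x hx]
    · intro w w' hww hw
      suffices inj : ∀ w, qW w ≠ 0 → ∀ w', qW w = qW w' → w = w' by
        exact inj w (fun h => hw ((hwz w).2 h)) w' (congrArg Subtype.val hww)
      clear hww hw w w'
      refine hcases _ ?_ ?_ ?_
      · intro y hw
        refine hcases _ ?_ ?_ ?_
        · intro y' h
          rw [q1, q1] at h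
          rw [q1, Ne, hS0] at hw
          rw [show y = y' from Subtype.ext (hSi _ _ _ _ h hw)]
        · intro y' u h
          rw [q2] at h; exact absurd h hw
        · intro x hx h
          rw [q1, q3] at h
          rw [q1, Ne, hS0] at hw
          have := hSi _ _ _ _ h hw
          exact absurd (this ▸ hmA y) hx
      · intro y u hw
        exact absurd (q2 _) hw
      · intro x hx hw
        refine hcases _ ?_ ?_ ?_
        · intro y' h
          rw [q1, q3] at h
          rw [q3, Ne, hS0] at hw
          have := hSi _ _ _ _ h hw
          exact absurd (this.symm ▸ hmA y') hx
        · intro y' u h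
          rw [q2] at h; exact absurd h hw
        · intro x' hx' h
          rw [q3, q3] at h
          rw [q3, Ne, hS0] at hw
          rw [show x = x' from Subtype.ext (hSi _ _ _ _ h hw)]
    · refine hcases _ ?_ ?_ ?_
      · intro y; rw [hH1, hA0]
      · intro y u; rw [hH2, hKC0]
      · intro x hx; rw [hH2, hKC0]
    · intro t w hw
      rw [ContinuousMap.coe_mk] at hw ⊢
      rw [hwz] at hw ⊢
      revert w
      refine hcases _ ?_ ?_ ?_
      · intro y hw
        rw [q1, hS0] at hw
        rw [hH1, q1, hS0]
        exact hAD _ _ hw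
      · intro y u hw
        rw [hH2, hKC1, q2]
      · intro x hx hw
        rw [q3, hS0] at hw
        exact absurd (by linarith) hx
    · intro w hw
      rw [ContinuousMap.coe_mk] at hw
      rw [hwz] at hw
      revert w
      refine hcases _ ?_ ?_ ?_
      · intro y hw
        rw [q1, hS0] at hw
        rw [hH1, hA1 _ hw]
      · intro y u hw
        rw [hH2, hKCone, hglue]
      · intro x hx hw
        rw [q3, hS0] at hw
        exact absurd (by linarith) hx
  obtain ⟨e1⟩ := e1
  obtain ⟨e2⟩ := e2
  exact ⟨e1.trans e2.symm⟩

end Aux4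

section Aux5
open SComplex

lemma aux_cfg {V : Type} (G : SimpleGraph V) (k : ℕ)
    (M : InducedMatching G k) (σ : Finset V)
    (ht : M.IsTransversal σ) (hd : IsDominating G σ) :
    ∃ a b, AuxCfg G k a b (↑M.vertexFinset) := by
  obtain ⟨hσ, ht⟩ := ht
  let a : Fin k → V := fun i => if M.fst i ∈ σ then M.fst i else M.snd i
  let b : Fin k → V := fun i => if M.fst i ∈ σ then M.snd i else M.fst i
  have hab : ∀ i, (a i = M.fst i ∧ b i = M.snd i) ∨ (a i = M.snd i ∧ b i = M.fst i) := by
    intro i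
    by_cases h : M.fst i ∈ σ
    · left; simp [a, b, h]
    · right; simp [a, b, h]
  have hmem : ∀ v, v ∈ M.vertexFinset ↔ (∃ i, v = a i) ∨ ∃ i, v = b i := by
    intro v
    simp only [InducedMatching.vertexFinset, Finset.mem_union, Finset.mem_image, Finset.mem_univ,
      true_and, ← exists_or]
    refine exists_congr fun i => ?_
    rcases hab i with ⟨h1, h2⟩ | ⟨h1, h2⟩ <;> rw [h1, h2]
    · exact or_congr eq_comm eq_comm
    · rw [or_comm]; exact or_congr eq_comm eq_comm
  have hb : ∀ i, b i ∉ σ := by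
    intro i
    rcases ht i with ⟨h1, h2⟩ | ⟨h1, h2⟩ <;> simp [b, h1, h2]
  have hσa : ∀ v ∈ σ, ∃ i, v = a i := by
    intro v hv
    rcases (hmem v).1 (hσ hv) with h | ⟨i, rfl⟩
    · exact h
    · exact absurd hv (hb i)
  have key : ∀ i j, i ≠ j → a i ≠ a j ∧ a i ≠ b j ∧ b i ≠ b j ∧
      ¬ G.Adj (a i) (a j) ∧ ¬ G.Adj (a i) (b j) ∧ ¬ G.Adj (b i) (b j) := by
    intro i j hij
    obtain ⟨d1, d2, d3, d4⟩ := M.disjoint i j hij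
    obtain ⟨n1, n2, n3, n4⟩ := M.induced i j hij
    rcases hab i with ⟨h1, h2⟩ | ⟨h1, h2⟩ <;> rcases hab j with ⟨h3, h4⟩ | ⟨h3, h4⟩ <;>
      rw [h1, h2, h3, h4] <;> exact ⟨by assumption, by assumption, by assumption, by assumption,
        by assumption, by assumption⟩
  have hadj : ∀ i, G.Adj (a i) (b i) := by
    intro i
    rcases hab i with ⟨h1, h2⟩ | ⟨h1, h2⟩ <;> rw [h1, h2]
    · exact M.adj i
    · exact (M.adj i).symm
  refine ⟨a, b, ?_, ?_, ?_, hmem, hadj, ?_, ?_, ?_, ?_⟩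
  · intro i j h; by_contra hij; exact (key i j hij).1 h
  · intro i j h; by_contra hij; exact (key i j hij).2.2.1 h
  · intro i j
    by_cases hij : i = j
    · subst hij; exact (hadj i).ne
    · exact (key i j hij).2.1
  · intro i j
    by_cases hij : i = j
    · subst hij; exact G.irrefl
    · exact (key i j hij).2.2.2.1
  · intro i j
    by_cases hij : i = j
    · subst hij; exact G.irrefl
    · exact (key i j hij).2.2.2.2.2
  · intro i j hij
    exact (key i j hij).2.2.2.2.1
  · intro v
    obtain ⟨w, hw, h⟩ := hd v
    obtain ⟨i, rfl⟩ := hσa w hw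
    rcases h with h | h
    · exact Or.inl ⟨i, h.symm⟩
    · exact Or.inr ⟨i, h⟩

end Aux5

/-- Let `(M, σ)` be an induced matching of size `k` with a dominating
transversal in a finite simple graph `G`, and let `j : I(M) → I(G)` be the embedding of
independence complexes induced by the inclusion of `M` as an induced subgraph (so `I(M)`
is the induced subcomplex of `I(G)` on the vertices of `M`).  Then
`I(G) ≃ I(M) ∨ C(j)`, where `C(j)` is the homotopy cofibre (mapping cone) of `j`;
moreover `I(M)` is the sphere `S^{k-1}`. -/
theorem statement9 {V : Type} [Fintype V] [Nonempty V] (G : SimpleGraph V) (k : ℕ)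
    (M : InducedMatching G k) (σ : Finset V)
    (ht : M.IsTransversal σ) (hd : IsDominating G σ) :
    (∃ (pm : realization (inducedSub (indepComplex G) ↑M.vertexFinset))
       (pc : MappingCone (inclMap (K := inducedSub (indepComplex G) ↑M.vertexFinset)
          (L := indepComplex G) (fun _ hs => hs.1))),
       Nonempty (ContinuousMap.HomotopyEquiv (realization (indepComplex G))
         (Wedge2 _ _ pm pc))) ∧
    Nonempty (realization (inducedSub (indepComplex G) ↑M.vertexFinset) ≃ₜ
      Metric.sphere (0 : EuclideanSpace ℝ (Fin k)) 1) := by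
  obtain ⟨a, b, c⟩ := aux_cfg G k M σ ht hd
  exact ⟨aux_main c, ⟨(aux_homeo c).choose⟩⟩
end
end
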